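/- The center of the group C is an infinite cyclic group (isomorphic to ℤ). -/

import Mathlib

/-- The vertices of the graph `T`: the 18 triangles of the triangulation of
the torus obtained from the 3×3 square grid with opposite sides identified.
A triangle is labelled by its unit cell `(a, b) : (ℤ/3)²` together with a
Boolean which is `false` for the lower triangle (below the diagonal of the
cell) and `true` for the upper one. -/
abbrev VT : Type := (ZMod 3 × ZMod 3) × Bool

/-- The 27 edges of the graph `T`, joining pairs of distinct triangles which
share a common side: edge `(c, 0)` is dual to the diagonal of the cell `c`,
edge `(c, 1)` to the left side of `c` and edge `(c, 2)` to the bottom side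
of `c`. -/
abbrev ET : Type := (ZMod 3 × ZMod 3) × Fin 3

/-- One endpoint of an edge of `T`. -/
def endA (e : ET) : VT :=
  if e.2 = 1 then (e.1, true) else (e.1, false)

/-- The other endpoint of an edge of `T`. -/
def endB (e : ET) : VT :=
  if e.2 = 0 then (e.1, true)
  else if e.2 = 1 then ((e.1.1 - 1, e.1.2), false)
  else ((e.1.1, e.1.2 - 1), true)

/-- Incidence between edges and vertices of `T`. -/
def incidentT (e : ET) (v : VT) : Prop := v = endA e ∨ v = endB e

/-- For each of the 9 grid vertices `p` of the torus, the six edges (in cyclic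
order) of the hexagonal cycle in `T` formed by the six triangles
containing `p`. -/
def hexEdge (p : ZMod 3 × ZMod 3) : Fin 6 → ET := fun k =>
  if k = 0 then (p, 2)
  else if k = 1 then (p, 0)
  else if k = 2 then (p, 1)
  else if k = 3 then ((p.1 - 1, p.2), 2)
  else if k = 4 then ((p.1 - 1, p.2 - 1), 0)
  else ((p.1, p.2 - 1), 1)

/-- The free-group generator corresponding to an edge `e` of `T`. -/
def fe (e : ET) : FreeGroup ET := FreeGroup.of e

/-- The relations of the presentation of the group `C`: `u_e² = 1`;
`u_e u_f = u_f u_e` when `e, f` have no common vertex;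
`u_e u_f u_e = u_f u_e u_f` when `e, f` share exactly one vertex; and the
cyclic relation `u_{e₁} u_{e₂} u_{e₃} u_{e₄} u_{e₅} = u_{e₂} u_{e₃} u_{e₄} u_{e₅} u_{e₆}`
for each of the nine hexagonal cycles. -/
def CRels : Set (FreeGroup ET) :=
  { r | (∃ e : ET, r = fe e * fe e)
      ∨ (∃ e f : ET, (∀ v : VT, ¬ (incidentT e v ∧ incidentT f v)) ∧
            r = fe e * fe f * (fe f * fe e)⁻¹)
      ∨ (∃ e f : ET, (∃! v : VT, incidentT e v ∧ incidentT f v) ∧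
            r = fe e * fe f * fe e * (fe f * fe e * fe f)⁻¹)
      ∨ (∃ p : ZMod 3 × ZMod 3,
            r = (fe (hexEdge p 0) * fe (hexEdge p 1) * fe (hexEdge p 2) *
                 fe (hexEdge p 3) * fe (hexEdge p 4)) *
                (fe (hexEdge p 1) * fe (hexEdge p 2) * fe (hexEdge p 3) *
                 fe (hexEdge p 4) * fe (hexEdge p 5))⁻¹) }

/-- The group `C`, given by the above presentation. -/
abbrev Cgrp : Type := PresentedGroup CRels

/-- The generator `u_e` of `C` corresponding to the edge `e` of `T`. -/
def uC (e : ET) : Cgrp := PresentedGroup.of e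

/-- The transposition in `S₁₈` exchanging the two triangles joined by the
edge `e` of `T`. -/
def tE (e : ET) : Equiv.Perm VT := Equiv.swap (endA e) (endB e)

open Equiv

/-- The product `s (m - 1) * s (m - 2) * ⋯ * s j` of `m - j` consecutive generators, where
`m = j + d`. -/
def descProd {G : Type*} [Group G] (s : ℕ → G) (j : ℕ) : ℕ → G
  | 0 => 1
  | d + 1 => s (j + d) * descProd s j d

section swaps
variable {V : Type*} [DecidableEq V] {a b c d : V}

theorem swap_mul_swap_comm (hac : a ≠ c) (had : a ≠ d) (hbc : b ≠ c) (hbd : b ≠ d) :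
    swap a b * swap c d = swap c d * swap a b := by
  rw [← mul_inv_eq_iff_eq_mul, ← swap_apply_apply, swap_apply_of_ne_of_ne hac.symm hbc.symm,
    swap_apply_of_ne_of_ne had.symm hbd.symm]

theorem swap_braid (hab : a ≠ b) (hac : a ≠ c) (hbc : b ≠ c) :
    swap a b * swap b c * swap a b = swap b c * swap a b * swap b c := by
  have h1 : swap a b * swap b c * swap a b = swap a c := by
    nth_rewrite 2 [← swap_inv a b]
    rw [← swap_apply_apply, swap_apply_right, swap_apply_of_ne_of_ne hac.symm hbc.symm]
  have h2 : swap b c * swap a b * swap b c = swap a c := by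
    nth_rewrite 2 [← swap_inv b c]
    rw [← swap_apply_apply, swap_apply_left, swap_apply_of_ne_of_ne hab hac]
  rw [h1, h2]

end swaps

section typeA
variable {G : Type*} [Group G] {s : ℕ → G} {n : ℕ}

theorem descProd_succ (s : ℕ → G) (j d : ℕ) :
    descProd s j (d + 1) = descProd s (j + 1) d * s j := by
  induction d with
  | zero => simp [descProd]
  | succ d ih =>
    rw [descProd, ih, descProd, mul_assoc]
    congr 2; omega

theorem descProd_mul_comm (comm : ∀ i j, i + 1 < j → j < n → s i * s j = s j * s i)
    {i j d : ℕ} (hij : i + 1 < j) (hd : j + d ≤ n) :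
    descProd s j d * s i = s i * descProd s j d := by
  induction d with
  | zero => simp [descProd]
  | succ d ih =>
    rw [descProd, mul_assoc, ih (by omega), ← mul_assoc, ← comm i (j + d) (by omega) (by omega),
      mul_assoc]

theorem descProd_mul_comm_above (comm : ∀ i j, i + 1 < j → j < n → s i * s j = s j * s i)
    {j d k : ℕ} (hd : j + d < k) (hk : k < n) :
    descProd s j d * s k = s k * descProd s j d := by
  induction d with
  | zero => simp [descProd]
  | succ d ih =>
    rw [descProd, mul_assoc, ih (by omega), ← mul_assoc, comm (j + d) k (by omega) (by omega),
      mul_assoc]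

theorem descProd_mul_braid (comm : ∀ i j, i + 1 < j → j < n → s i * s j = s j * s i)
    (braid : ∀ i, i + 1 < n → s i * s (i + 1) * s i = s (i + 1) * s i * s (i + 1))
    {j k d : ℕ} (hk : k + 1 < j + d) (hjk : j ≤ k) (hd : j + d ≤ n) :
    descProd s j d * s (k + 1) = s k * descProd s j d := by
  induction d with
  | zero => omega
  | succ d ih =>
    rcases Nat.lt_or_ge (k + 1) (j + d) with h | h
    · rw [descProd, mul_assoc, ih h (by omega), ← mul_assoc, ← mul_assoc,
        comm k (j + d) (by omega) (by omega)]
    · obtain ⟨d, rfl⟩ : ∃ d', d = d' + 1 := ⟨d - 1, by omega⟩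
      obtain rfl : k = j + d := by omega
      simp only [descProd]
      rw [show j + (d + 1) = j + d + 1 by omega, mul_assoc, mul_assoc,
        descProd_mul_comm_above comm (by omega) (by omega)]
      simp only [← mul_assoc]
      rw [braid _ (by omega)]

theorem exists_mul_descProd (sq : ∀ i < n, s i * s i = 1)
    (comm : ∀ i j, i + 1 < j → j < n → s i * s j = s j * s i)
    (braid : ∀ i, i + 1 < n → s i * s (i + 1) * s i = s (i + 1) * s i * s (i + 1))
    {m : ℕ} (hm : m + 1 ≤ n) {g : G} (hg : g ∈ Subgroup.closure (s '' Set.Iio (m + 1))) :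
    ∃ w ∈ Subgroup.closure (s '' Set.Iio m), ∃ j d, j + d = m + 1 ∧ g = w * descProd s j d := by
  have key : ∀ w ∈ Subgroup.closure (s '' Set.Iio m), ∀ j d, j + d = m + 1 → ∀ k < m + 1,
      ∃ w' ∈ Subgroup.closure (s '' Set.Iio m), ∃ j' d', j' + d' = m + 1 ∧
        w * descProd s j d * s k = w' * descProd s j' d' := by
    intro w hw j d hjd k hk
    have mem : ∀ i < m, w * s i ∈ Subgroup.closure (s '' Set.Iio m) := fun i hi =>
      mul_mem hw (Subgroup.subset_closure ⟨i, hi, rfl⟩)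
    rcases lt_trichotomy (k + 1) j with h | h | h
    · refine ⟨w * s k, mem k (by omega), j, d, hjd, ?_⟩
      rw [mul_assoc, descProd_mul_comm comm h (by omega), mul_assoc]
    · exact ⟨w, hw, k, d + 1, by omega, by rw [descProd_succ, h, mul_assoc]⟩
    · obtain rfl | h := (show j ≤ k by omega).eq_or_lt
      · obtain ⟨d, rfl⟩ : ∃ d', d = d' + 1 := ⟨d - 1, by omega⟩
        refine ⟨w, hw, j + 1, d, by omega, ?_⟩
        rw [descProd_succ, mul_assoc, mul_assoc, sq j (by omega), mul_one]
      · obtain ⟨k, rfl⟩ : ∃ k', k = k' + 1 := ⟨k - 1, by omega⟩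
        refine ⟨w * s k, mem k (by omega), j, d, hjd, ?_⟩
        rw [mul_assoc, descProd_mul_braid comm braid (by omega) (by omega) (by omega), mul_assoc]
  induction hg using Subgroup.closure_induction_right with
  | one => exact ⟨1, one_mem _, m + 1, 0, rfl, by simp [descProd]⟩
  | mul_right g t _ ht ih =>
    obtain ⟨k, hk, rfl⟩ := ht
    obtain ⟨w, hw, j, d, hjd, rfl⟩ := ih
    exact key w hw j d hjd k hk
  | mul_inv_cancel g t _ ht ih =>
    obtain ⟨k, hk, rfl⟩ := ht
    obtain ⟨w, hw, j, d, hjd, rfl⟩ := ih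
    rw [inv_eq_of_mul_eq_one_left (sq k (lt_of_lt_of_le hk hm))]
    exact key w hw j d hjd k hk

theorem eq_one_of_map_eq_one (sq : ∀ i < n, s i * s i = 1)
    (comm : ∀ i j, i + 1 < j → j < n → s i * s j = s j * s i)
    (braid : ∀ i, i + 1 < n → s i * s (i + 1) * s i = s (i + 1) * s i * s (i + 1))
    {V : Type*} [DecidableEq V] {v : ℕ → V} (hv : Set.InjOn v (Set.Iic n)) (π : G →* Perm V)
    (hπ : ∀ i < n, π (s i) = swap (v i) (v (i + 1)))
    {m : ℕ} (hm : m ≤ n) {g : G} (hg : g ∈ Subgroup.closure (s '' Set.Iio m)) (h1 : π g = 1) :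
    g = 1 := by
  induction m generalizing g with
  | zero => simpa using hg
  | succ m ih =>
    obtain ⟨w, hw, j, d, hjd, rfl⟩ := exists_mul_descProd sq comm braid hm hg
    have fix : ∀ w ∈ Subgroup.closure (s '' Set.Iio m), π w (v (m + 1)) = v (m + 1) := by
      intro w hw
      induction hw using Subgroup.closure_induction with
      | mem t ht =>
        obtain ⟨k, hk, rfl⟩ := ht
        have hk : k < m := hk
        rw [hπ k (by omega)]
        apply swap_apply_of_ne_of_ne
        · intro h; have := hv (by simp; omega) (by simp; omega) h; omega
        · intro h; have := hv (by simp; omega) (by simp; omega) h; omega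
      | one => simp
      | mul a b _ _ ha hb => simp [ha, hb]
      | inv a _ ha => rw [map_inv, Perm.inv_eq_iff_eq, ha]
    have move : ∀ d, j + d ≤ n → π (descProd s j d) (v j) = v (j + d) := by
      intro d hd
      induction d with
      | zero => simp [descProd]
      | succ d ihd =>
        rw [descProd, map_mul, Perm.mul_apply, ihd (by omega), hπ _ (by omega), swap_apply_left]
        rfl
    have h2 := congrArg (fun σ : Perm V => σ (v j)) h1
    simp only [map_mul, Perm.mul_apply, move d (by omega), hjd, fix w hw, Perm.one_apply] at h2
    have := hv (by simp; omega) (by simp; omega) h2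
    obtain rfl : d = 0 := by omega
    simp only [descProd, mul_one] at h1 ⊢
    exact ih (by omega) hw h1

/-- The symmetric group satisfies the universal property of the Coxeter group of type `A`. -/
theorem exists_perm_hom (sq : ∀ i < n, s i * s i = 1)
    (comm : ∀ i j, i + 1 < j → j < n → s i * s j = s j * s i)
    (braid : ∀ i, i + 1 < n → s i * s (i + 1) * s i = s (i + 1) * s i * s (i + 1)) :
    ∃ f : Perm (Fin (n + 1)) →* G, ∀ i : Fin n, f (swap i.castSucc i.succ) = s i := by
  let v : ℕ → Fin (n + 1) := fun i => Fin.ofNat (n + 1) i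
  have hvi : Set.InjOn v (Set.Iic n) := by
    intro a ha b hb h
    have ha : a ≤ n := ha
    have hb : b ≤ n := hb
    have := congrArg Fin.val h
    simp only [v, Fin.ofNat] at this
    rwa [Nat.mod_eq_of_lt (by omega), Nat.mod_eq_of_lt (by omega)] at this
  have vne : ∀ a b, a ≤ n → b ≤ n → a ≠ b → v a ≠ v b := fun a b ha hb hab h =>
    hab (hvi ha hb h)
  let t : ℕ → Perm (Fin (n + 1)) × G := fun i => (swap (v i) (v (i + 1)), s i)
  let D := Subgroup.closure (t '' Set.Iio n)
  have tv : ∀ i : Fin n, t i = (swap i.castSucc i.succ, s i) := by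
    intro i
    have h1 : v i = i.castSucc := by
      ext; simp only [v, Fin.ofNat, Fin.val_castSucc]; exact Nat.mod_eq_of_lt (by omega)
    have h2 : v (i + 1) = i.succ := by
      ext; simp only [v, Fin.ofNat, Fin.val_succ]; exact Nat.mod_eq_of_lt (by omega)
    simp only [t, h1, h2]
  have inj : ∀ g ∈ D, g.1 = 1 → g = 1 := by
    intro g hg h1
    refine eq_one_of_map_eq_one (s := t) (n := n) ?_ ?_ ?_ hvi (MonoidHom.fst _ _)
      (fun i _ => rfl) le_rfl hg h1
    · intro i hi; simp [t, sq i hi]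
    · intro i j hij hj
      refine Prod.ext ?_ (comm i j hij hj)
      exact swap_mul_swap_comm (vne _ _ (by omega) (by omega) (by omega))
        (vne _ _ (by omega) (by omega) (by omega)) (vne _ _ (by omega) (by omega) (by omega))
        (vne _ _ (by omega) (by omega) (by omega))
    · intro i hi
      refine Prod.ext ?_ (braid i hi)
      exact swap_braid (vne _ _ (by omega) (by omega) (by omega))
        (vne _ _ (by omega) (by omega) (by omega)) (vne _ _ (by omega) (by omega) (by omega))
  have surj : ∀ σ : Perm (Fin (n + 1)), ∃ g : G, (σ, g) ∈ D := by
    intro σ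
    have hσ : σ ∈ Submonoid.closure (Set.range fun i : Fin n => swap i.castSucc i.succ) := by
      rw [Perm.mclosure_swap_castSucc_succ]; trivial
    induction hσ using Submonoid.closure_induction with
    | mem τ hτ =>
      obtain ⟨i, rfl⟩ := hτ
      exact ⟨s i, Subgroup.subset_closure ⟨i, i.2, tv i⟩⟩
    | one => exact ⟨1, one_mem D⟩
    | mul a b _ _ ha hb =>
      obtain ⟨g, hg⟩ := ha
      obtain ⟨h, hh⟩ := hb
      exact ⟨g * h, mul_mem hg hh⟩
  choose f hf using surj
  have uniq : ∀ σ g, (σ, g) ∈ D → f σ = g := by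
    intro σ g hg
    have := inj _ (mul_mem (hf σ) (inv_mem hg)) (by simp)
    exact mul_inv_eq_one.1 (congrArg Prod.snd this)
  refine ⟨MonoidHom.mk' f fun a b => uniq _ _ (mul_mem (hf a) (hf b)), fun i => ?_⟩
  exact uniq _ _ (Subgroup.subset_closure ⟨i, i.2, tv i⟩)

end typeA

section translations
variable {G : Type*} [Group G] {V : Type*} [DecidableEq V]

/-- A family of elements `x i j` of a group on which `Perm V` acts through `S`, behaving like the
translations by the differences of basis vectors in the affine Weyl group of type `A`. -/
structure IsTranslationFamily (S : Perm V →* G) (x : V → V → G) : Prop where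
  mul : ∀ i j k, x i j * x j k = x i k
  comm : ∀ i j k l, Commute (x i j) (x k l)
  conj : ∀ σ i j, S σ * x i j * (S σ)⁻¹ = x (σ i) (σ j)

theorem exists_perm_apply_eq {i₀ j₀ i j : V} (h₀ : i₀ ≠ j₀) (h : i ≠ j) :
    ∃ σ : Perm V, σ i₀ = i ∧ σ j₀ = j := by
  have hw : i ≠ swap i₀ i j₀ := fun hw => h₀ <| by
    rw [eq_comm, swap_apply_eq_iff, swap_apply_right] at hw
    exact hw.symm
  exact ⟨swap (swap i₀ i j₀) j * swap i₀ i, by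
    simp [swap_apply_of_ne_of_ne hw h], by simp⟩

theorem commute_of_fixes [Finite V] {S : Perm V →* G} {i₀ j₀ : V} {u : G}
    (hu : ∀ k l, k ≠ i₀ → k ≠ j₀ → l ≠ i₀ → l ≠ j₀ → Commute u (S (swap k l)))
    {σ : Perm V} (hi : σ i₀ = i₀) (hj : σ j₀ = j₀) : Commute u (S σ) := by
  let p : V → Prop := fun v => v ≠ i₀ ∧ v ≠ j₀
  have hp : ∀ v, p (σ v) ↔ p v := by
    intro v
    refine and_congr (not_congr ?_) (not_congr ?_)
    · conv_lhs => rw [← hi]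
      exact σ.injective.eq_iff
    · conv_lhs => rw [← hj]
      exact σ.injective.eq_iff
  have hσ : Perm.ofSubtype (σ.subtypePerm hp) = σ := by
    apply Perm.ofSubtype_subtypePerm
    intro v hv
    constructor
    · rintro rfl; exact hv hi
    · rintro rfl; exact hv hj
  rw [← hσ]
  generalize σ.subtypePerm hp = τ
  induction τ using Perm.swap_induction_on with
  | one => simp
  | swap_mul f a b _ ih =>
    rw [map_mul, map_mul, Perm.ofSubtype_swap_eq]
    exact (hu _ _ a.2.1 a.2.2 b.2.1 b.2.2).mul_right ih

theorem exists_translationFamily [Finite V] {S : Perm V →* G} {i₀ j₀ : V} (h₀ : i₀ ≠ j₀) {u : G}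
    (sq : u * u = 1)
    (hu : ∀ k l, k ≠ i₀ → k ≠ j₀ → l ≠ i₀ → l ≠ j₀ → Commute u (S (swap k l)))
    (bi : ∃ k, k ≠ i₀ ∧ k ≠ j₀ ∧
      u * S (swap i₀ k) * u = S (swap i₀ k) * u * S (swap i₀ k))
    (bj : ∃ k, k ≠ i₀ ∧ k ≠ j₀ ∧
      u * S (swap j₀ k) * u = S (swap j₀ k) * u * S (swap j₀ k)) :
    ∃ x, IsTranslationFamily S x ∧ x i₀ j₀ = u * S (swap i₀ j₀) := by
  classical
  have Sinv : ∀ a b, (S (swap a b))⁻¹ = S (swap a b) := fun a b => by rw [← map_inv, swap_inv]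
  have braid : ∀ w, (w = i₀ ∨ w = j₀) → (∃ k, k ≠ i₀ ∧ k ≠ j₀ ∧
      u * S (swap w k) * u = S (swap w k) * u * S (swap w k)) → ∀ k, k ≠ i₀ → k ≠ j₀ →
      u * S (swap w k) * u = S (swap w k) * u * S (swap w k) := by
    rintro w hw ⟨l, hli, hlj, hb⟩ k hki hkj
    have hwl : w ≠ l := by rcases hw with rfl | rfl; exacts [hli.symm, hlj.symm]
    have hwk : w ≠ k := by rcases hw with rfl | rfl; exacts [hki.symm, hkj.symm]
    have h1 : S (swap l k) * S (swap w l) * (S (swap l k))⁻¹ = S (swap w k) := by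
      rw [← map_inv, ← map_mul, ← map_mul, ← swap_apply_apply, swap_apply_left,
        swap_apply_of_ne_of_ne hwl hwk]
    have h2 : S (swap l k) * u * (S (swap l k))⁻¹ = u := by
      rw [← (hu l k hli hlj hki hkj).eq, mul_inv_cancel_right]
    have h3 := congrArg (fun g => S (swap l k) * g * (S (swap l k))⁻¹) hb
    simpa only [← conj_mul, h1, h2] using h3
  replace bi := braid i₀ (.inl rfl) bi
  replace bj := braid j₀ (.inr rfl) bj
  set r := S (swap i₀ j₀) with hr
  have hS : ∀ σ τ : Perm V, σ i₀ = τ i₀ → σ j₀ = τ j₀ →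
      S σ * (u * r) * (S σ)⁻¹ = S τ * (u * r) * (S τ)⁻¹ := by
    intro σ τ hi hj
    have h1 : (τ⁻¹ * σ) i₀ = i₀ := by rw [Perm.mul_apply, hi]; exact τ.symm_apply_apply _
    have h2 : (τ⁻¹ * σ) j₀ = j₀ := by rw [Perm.mul_apply, hj]; exact τ.symm_apply_apply _
    have h3 : Commute r (S (τ⁻¹ * σ)) := by
      change S _ * S _ = S _ * S _
      rw [← map_mul, ← map_mul, mul_swap_eq_swap_mul, h1, h2]
    have h4 := ((commute_of_fixes hu h1 h2).mul_left h3).eq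
    rw [map_mul, map_inv] at h4
    have h5 := congrArg (fun g => S τ * g * (S σ)⁻¹) h4
    simp only [mul_assoc, mul_inv_cancel_left, mul_inv_cancel, mul_one] at h5
    simp only [mul_assoc, h5]
  have hex : ∀ i j, ∃ σ : Perm V, i ≠ j → σ i₀ = i ∧ σ j₀ = j := by
    intro i j
    by_cases h : i = j
    · exact ⟨1, fun h' => absurd h h'⟩
    · obtain ⟨σ, hσ⟩ := exists_perm_apply_eq h₀ h
      exact ⟨σ, fun _ => hσ⟩
  choose p hp using hex
  let x : V → V → G := fun i j => if i = j then 1 else S (p i j) * (u * r) * (S (p i j))⁻¹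
  have xself : ∀ i, x i i = 1 := fun i => if_pos rfl
  have xspec : ∀ σ, S σ * (u * r) * (S σ)⁻¹ = x (σ i₀) (σ j₀) := by
    intro σ
    have hne : σ i₀ ≠ σ j₀ := σ.injective.ne h₀
    obtain ⟨h1, h2⟩ := hp _ _ hne
    change _ = ite _ _ _
    rw [if_neg hne]
    exact hS _ _ h1.symm h2.symm
  have x₀ : x i₀ j₀ = u * r := by simpa using (xspec 1).symm
  have xconj : ∀ σ i j, S σ * x i j * (S σ)⁻¹ = x (σ i) (σ j) := by
    intro σ i j
    by_cases h : i = j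
    · simp [h, xself]
    · obtain ⟨h1, h2⟩ := hp _ _ h
      have h3 := xspec (σ * p i j)
      have h4 := xspec (p i j)
      rw [h1, h2] at h4
      rw [Perm.mul_apply, Perm.mul_apply, h1, h2] at h3
      rw [← h3, ← h4, map_mul, mul_inv_rev]
      simp only [mul_assoc]
  have rr : ∀ z, r * (r * z) = z := fun z => by
    rw [← mul_assoc, hr, ← map_mul, swap_mul_self, map_one, one_mul]
  have rr1 : r * r = 1 := by simpa using rr 1
  have xinv₀ : x j₀ i₀ * x i₀ j₀ = 1 := by
    have h1 := xspec (swap i₀ j₀)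
    rw [swap_apply_left, swap_apply_right, Sinv] at h1
    rw [← h1, x₀, ← hr]
    simp only [mul_assoc, rr]
    rw [← mul_assoc u, sq, one_mul, rr1]
  have chain₀ : ∀ k, k ≠ i₀ → k ≠ j₀ →
      x i₀ j₀ * x j₀ k = x i₀ k ∧ x j₀ k * x i₀ j₀ = x i₀ k := by
    intro k hki hkj
    have bj := bj k hki hkj
    have bi := bi k hki hkj
    set s := S (swap j₀ k) with hs
    have ss : ∀ z, s * (s * z) = z := fun z => by
      rw [← mul_assoc, hs, ← map_mul, swap_mul_self, map_one, one_mul]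
    have hq : S (swap i₀ k) = r * s * r := by
      rw [hr, hs, ← map_mul, ← map_mul]
      nth_rewrite 2 [← swap_inv i₀ j₀]
      rw [← swap_apply_apply, swap_apply_right, swap_apply_of_ne_of_ne hki hkj]
    have hq' : S (swap i₀ k) = s * r * s := by
      rw [hr, hs, ← map_mul, ← map_mul]
      nth_rewrite 2 [← swap_inv j₀ k]
      rw [← swap_apply_apply, swap_apply_left, swap_apply_of_ne_of_ne h₀ hki.symm]
    have srs : r * (s * r) = s * (r * s) := by rw [← mul_assoc, ← mul_assoc, ← hq, hq']
    have hik : x i₀ k = s * (u * (r * s)) := by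
      have h1 := xspec (swap j₀ k)
      rw [swap_apply_left, swap_apply_of_ne_of_ne h₀ hki.symm, Sinv, ← hs] at h1
      rw [← h1]; simp only [mul_assoc]
    have hjk : x j₀ k = r * (s * (u * (r * (s * r)))) := by
      have h1 := xspec (swap i₀ j₀ * swap j₀ k)
      rw [Perm.mul_apply, Perm.mul_apply, swap_apply_of_ne_of_ne h₀ hki.symm, swap_apply_left,
        swap_apply_left, swap_apply_of_ne_of_ne hki hkj, map_mul, mul_inv_rev, Sinv, Sinv, ← hs,
        ← hr] at h1
      rw [← h1]; simp only [mul_assoc]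
    have bj' : ∀ z, u * (s * (u * z)) = s * (u * (s * z)) := fun z => by
      simpa only [mul_assoc] using congrArg (· * z) bj
    rw [hq] at bi
    have bi' : ∀ z, u * (r * (s * (r * (u * z)))) = r * (s * (r * (u * (r * (s * (r * z)))))) :=
      fun z => by simpa only [mul_assoc] using congrArg (· * z) bi
    rw [hik, hjk, x₀]
    constructor
    · rw [mul_assoc, rr, bj', srs, ss]
    · simp only [mul_assoc]
      rw [bi' r, rr1, mul_one]
      have : ∀ z, s * (r * (s * (r * z))) = r * (s * z) := fun z => by
        have := congrArg (· * (r * z)) srs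
        simp only [mul_assoc, rr] at this
        exact this.symm
      rw [this, rr]
  have chain : ∀ i j k, i ≠ j → j ≠ k → i ≠ k →
      x i j * x j k = x i k ∧ x j k * x i j = x i k := by
    intro i j k hij hjk hik
    obtain ⟨σ, rfl, rfl⟩ := exists_perm_apply_eq h₀ hij
    have h := chain₀ (σ⁻¹ k) (fun h => hik (by simp [← h])) (fun h => hjk (by simp [← h]))
    have h1 := congrArg (fun g => S σ * g * (S σ)⁻¹) h.1
    have h2 := congrArg (fun g => S σ * g * (S σ)⁻¹) h.2
    have hk : σ (σ⁻¹ k) = k := σ.apply_symm_apply k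
    simp only [← conj_mul, xconj, hk] at h1 h2
    exact ⟨h1, h2⟩
  have inv : ∀ i j, x j i * x i j = 1 := by
    intro i j
    by_cases h : i = j
    · simp [h, xself]
    · obtain ⟨σ, rfl, rfl⟩ := exists_perm_apply_eq h₀ h
      have h1 := congrArg (fun g => S σ * g * (S σ)⁻¹) xinv₀
      simpa only [← conj_mul, xconj, mul_one, mul_inv_cancel] using h1
  have xmul : ∀ i j k, x i j * x j k = x i k ∧ x j k * x i j = x i k := by
    intro i j k
    by_cases h1 : i = j
    · simp [h1, xself]
    by_cases h2 : j = k
    · simp [h2, xself]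
    by_cases h3 : i = k
    · subst h3; simp [inv, xself]
    exact chain i j k h1 h2 h3
  have xinv : ∀ i j, (x i j)⁻¹ = x j i := fun i j => inv_eq_of_mul_eq_one_left (inv i j)
  have c1 : ∀ i j k, Commute (x i j) (x i k) := by
    intro i j k
    rw [← (xmul i j k).1]
    refine (Commute.refl _).mul_right ?_
    exact (xmul i j k).1.trans (xmul i j k).2.symm
  refine ⟨x, ⟨fun i j k => (xmul i j k).1, fun i j k l => ?_, xconj⟩, x₀⟩
  rw [← (xmul k i l).1, ← xinv i k]
  exact (c1 i j k).inv_right.mul_right (c1 i j l)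

end translations

section heisenberg
open scoped commutatorElement
variable {G : Type*} [Group G]

namespace IsTranslationFamily
variable {V : Type*} {S : Perm V →* G} {x : V → V → G}

theorem self (hx : IsTranslationFamily S x) (i : V) : x i i = 1 :=
  mul_eq_left.1 (hx.mul i i i)

theorem inv (hx : IsTranslationFamily S x) (i j : V) : (x i j)⁻¹ = x j i :=
  inv_eq_of_mul_eq_one_left ((hx.mul j i j).trans (hx.self j))

theorem mul' (hx : IsTranslationFamily S x) (i j k : V) : x j k * x i j = x i k :=
  (hx.comm j k i j).eq.trans (hx.mul i j k)

end IsTranslationFamily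

theorem commutator_mul_left_of_commute {a b c : G} (h : Commute b c) : ⁅a * b, c⁆ = ⁅a, c⁆ := by
  simp only [commutatorElement_def, mul_inv_rev]
  rw [mul_assoc a b c, h.eq]
  group

theorem commutator_mul_right_of_commute {a b c : G} (h : Commute a c) : ⁅a, b * c⁆ = ⁅a, b⁆ := by
  simp only [commutatorElement_def, mul_inv_rev]
  rw [mul_assoc (a * (b * c)), ← mul_assoc a⁻¹, (h.inv_left.inv_right).eq]
  rw [← mul_assoc a b c]
  group

/-- The exponent of the commutator of the translations by `e i - e j` and `e k - e l`. -/
def pairing {V : Type*} [DecidableEq V] (i j k l : V) : ℤ :=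
  (if i = k then 1 else 0) - (if i = l then 1 else 0) - (if j = k then 1 else 0) +
    (if j = l then 1 else 0)

section conjZpow
variable {c : G} (hc : c ∈ Subgroup.center G) {a a' b b' : G} {m n : ℤ}
include hc

theorem zpow_comm_of_center (n : ℤ) (g : G) : g * c ^ n = c ^ n * g :=
  Subgroup.mem_center_iff.1 (Subgroup.zpow_mem _ hc n) g

theorem conj_zpow_mul_left (h : a * b * a⁻¹ = b * c ^ m) (h' : a' * b * a'⁻¹ = b * c ^ n) :
    a * a' * b * (a * a')⁻¹ = b * c ^ (m + n) := by
  calc a * a' * b * (a * a')⁻¹ = a * (a' * b * a'⁻¹) * a⁻¹ := by group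
    _ = a * b * a⁻¹ * c ^ n := by
      rw [h', mul_assoc _ a⁻¹, zpow_comm_of_center hc n a⁻¹]; simp only [mul_assoc]
    _ = b * c ^ (m + n) := by rw [h, zpow_add, mul_assoc]

theorem conj_zpow_inv_left (h : a * b * a⁻¹ = b * c ^ m) :
    a⁻¹ * b * a⁻¹⁻¹ = b * c ^ (-m) := by
  have h1 : b = a⁻¹ * (b * c ^ m) * a := by rw [← h]; group
  rw [zpow_neg, eq_mul_inv_iff_mul_eq, inv_inv, mul_assoc _ a, zpow_comm_of_center hc m a]
  conv_rhs => rw [h1]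
  simp only [mul_assoc]

theorem conj_zpow_mul_right (h : a * b * a⁻¹ = b * c ^ m) (h' : a * b' * a⁻¹ = b' * c ^ n) :
    a * (b * b') * a⁻¹ = b * b' * c ^ (m + n) := by
  rw [← conj_mul, h, h', mul_assoc b, ← mul_assoc _ b', ← zpow_comm_of_center hc m b', zpow_add]
  simp only [mul_assoc]

theorem conj_zpow_inv_right (h : a * b * a⁻¹ = b * c ^ m) :
    a * b⁻¹ * a⁻¹ = b⁻¹ * c ^ (-m) := by
  rw [← conj_inv, h, mul_inv_rev, zpow_neg, ← zpow_neg, zpow_comm_of_center hc]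

end conjZpow

section pair
variable {V : Type*} [DecidableEq V] {S : Perm V →* G} {x y : V → V → G}

theorem exists_commutator_eq (h6 : ∀ a b c d e : V, ∃ z, z ≠ a ∧ z ≠ b ∧ z ≠ c ∧ z ≠ d ∧ z ≠ e)
    (hx : IsTranslationFamily S x) (hy : IsTranslationFamily S y)
    (disj : ∀ i j k l, i ≠ k → i ≠ l → j ≠ k → j ≠ l → Commute (x i j) (y k l))
    (hR : ∀ i j k, i ≠ j → j ≠ k → i ≠ k → x i j * y i k * x j k = y i j * x i k * y j k)
    (gen : Subgroup.closure
      (Set.range S ∪ Set.range (fun p : V × V => x p.1 p.2) ∪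
        Set.range (fun p : V × V => y p.1 p.2)) = ⊤) :
    ∃ c ∈ Subgroup.center G,
      (∀ i j k l, x i j * y k l * (x i j)⁻¹ = y k l * c ^ pairing i j k l) := by
  have E1 : ∀ i i' j k, i ≠ k → i' ≠ k → i ≠ j → i' ≠ j → k ≠ j →
      ⁅x i j, y k j⁆ = ⁅x i' j, y k j⁆ := by
    intro i i' j k h1 h2 h3 h4 h5
    rw [← hx.mul' i i' j, commutator_mul_left_of_commute (disj i i' k j h1 h3 h2 h4)]
  have E2 : ∀ i j k k', i ≠ k → i ≠ k' → i ≠ j → k ≠ j → k' ≠ j →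
      ⁅x i j, y k j⁆ = ⁅x i j, y k' j⁆ := by
    intro i j k k' h1 h2 h3 h4 h5
    rw [← hy.mul' k k' j, commutator_mul_right_of_commute (disj i j k k' h1 h2 h4.symm h5.symm)]
  have E3 : ∀ i j k i' k', i ≠ j → k ≠ j → i ≠ k → i' ≠ j → k' ≠ j → i' ≠ k' →
      ⁅x i j, y k j⁆ = ⁅x i' j, y k' j⁆ := by
    intro i j k i' k' h1 h2 h3 h4 h5 h6'
    obtain ⟨z, z1, z2, z3, -⟩ := h6 i i' j j j
    rw [E2 i j k z h3 z1.symm h1 h2 z3, E1 i i' j z z1.symm z2.symm h1 h4 z3,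
      E2 i' j z k' z2.symm h6' h4 z3 h5]
  have D0 : ∀ i j l m n, i ≠ j → l ≠ i → l ≠ j → m ≠ i → m ≠ j → m ≠ l → n ≠ i → n ≠ j →
      n ≠ l → m ≠ n → ⁅x i j, y i j⁆ = ⁅x i j, y i l⁆ * ⁅x m j, y n j⁆ := by
    intro i j l m n hij hli hlj hmi hmj hml hni hnj hnl hmn
    have hcomm : Commute (y i l) ⁅x m j, y n j⁆ := by
      have h1 : Commute (y i l) (x m j) := (disj m j i l hmi hml hij.symm hlj.symm).symm
      have h2 : Commute (y i l) (y n j) := hy.comm _ _ _ _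
      rw [commutatorElement_def]
      exact ((h1.mul_right h2).mul_right h1.inv_right).mul_right h2.inv_right
    have h3 : ⁅x i j, y l j⁆ = ⁅x m j, y n j⁆ := E3 _ _ _ _ _ hij hlj hli.symm hmj hnj hmn
    have h4 : ⁅x i j, y i l * y l j⁆ =
        ⁅x i j, y i l⁆ * (y i l * ⁅x i j, y l j⁆ * (y i l)⁻¹) := by
      simp only [commutatorElement_def]; group
    rw [← hy.mul i l j, h4, h3, hcomm.eq, mul_inv_cancel_right]
  have D1 : ∀ i j k, i ≠ j → j ≠ k → i ≠ k → ⁅x j i, y j i⁆ = ⁅x j k, y j k⁆ := by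
    intro i j k h1 h2 h3
    have h := hR i j k h1 h2 h3
    rw [← hy.mul i j k, ← hx.mul i j k] at h
    have h' : (y i j * x i j)⁻¹ * (x i j * y i j) =
        (x j k * y j k) * (y j k * x j k)⁻¹ := by
      rw [inv_mul_eq_iff_eq_mul, ← mul_assoc, eq_mul_inv_iff_mul_eq]
      simpa only [mul_assoc] using h
    simp only [commutatorElement_def, hx.inv, hy.inv]
    simpa only [mul_inv_rev, hx.inv, hy.inv, ← mul_assoc] using h'
  have E4 : ∀ j j' i k i' k', i ≠ j → k ≠ j → i ≠ k → i' ≠ j' → k' ≠ j' → i' ≠ k' → j ≠ j' →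
      ⁅x i j, y k j⁆ = ⁅x i' j', y k' j'⁆ := by
    intro j j' i k i' k' h1 h2 h3 h1' h2' h3' hj
    obtain ⟨o, o1, o2, -⟩ := h6 j j' j j j
    obtain ⟨l, l1, l2, l3, -⟩ := h6 j j' o o o
    obtain ⟨m, m1, m2, m3, m4, -⟩ := h6 j j' o l l
    obtain ⟨n, n1, n2, n3, n4, n5⟩ := h6 j j' o l m
    rw [E3 i j k m n h1 h2 h3 m1 n1 n5.symm, E3 i' j' k' m n h1' h2' h3' m2 n2 n5.symm]
    have h4 := D0 o j l m n o1 l3 l1 m3 m1 m4 n3 n1 n4 n5.symm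
    have h5 := D0 o j' l m n o2 l3 l2 m3 m2 m4 n3 n2 n4 n5.symm
    have h7 : ⁅x o j, y o l⁆ = ⁅x o j', y o l⁆ := by
      rw [← hx.mul o j' j,
        commutator_mul_left_of_commute (disj j' j o l o2.symm l2.symm o1.symm l1.symm)]
    rw [D1 j o j' o1.symm o2 hj, h5, h7] at h4
    exact (mul_left_cancel h4).symm
  by_cases hV : IsEmpty V
  · exact ⟨1, one_mem _, fun i => (IsEmpty.false i).elim⟩
  rw [not_isEmpty_iff] at hV
  obtain ⟨j₀⟩ := hV
  obtain ⟨i₀, hi₀, -⟩ := h6 j₀ j₀ j₀ j₀ j₀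
  obtain ⟨k₀, hk₀, hk₀', -⟩ := h6 j₀ i₀ j₀ j₀ j₀
  obtain ⟨c, hc⟩ : ∃ c, ∀ i j k, i ≠ j → k ≠ j → i ≠ k → ⁅x i j, y k j⁆ = c := by
    refine ⟨⁅x i₀ j₀, y k₀ j₀⁆, fun i j k h1 h2 h3 => ?_⟩
    rcases eq_or_ne j j₀ with rfl | hj
    · exact E3 _ _ _ _ _ h1 h2 h3 hi₀ hk₀ hk₀'.symm
    · exact E4 _ _ _ _ _ _ h1 h2 h3 hi₀ hk₀ hk₀'.symm hj
  have hcx : ∀ l m : V, ∃ i j k : V, i ≠ j ∧ k ≠ j ∧ i ≠ k ∧ i ≠ l ∧ i ≠ m ∧ j ≠ l ∧ j ≠ m ∧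
      k ≠ l ∧ k ≠ m := by
    intro l m
    obtain ⟨i, i1, i2, -⟩ := h6 l m m m m
    obtain ⟨j, j1, j2, j3, -⟩ := h6 l m i i i
    obtain ⟨k, k1, k2, k3, k4, -⟩ := h6 l m i j j
    exact ⟨i, j, k, j3.symm, k4, k3.symm, i1, i2, j1, j2, k1, k2⟩
  have hcenter : c ∈ Subgroup.center G := by
    rw [← Subgroup.centralizer_univ, ← Subgroup.coe_top, ← gen, Subgroup.centralizer_closure,
      Subgroup.mem_centralizer_iff]
    have comm4 : ∀ g a b : G, Commute g a → Commute g b → g * ⁅a, b⁆ = ⁅a, b⁆ * g := by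
      intro g a b h1 h2
      rw [commutatorElement_def]
      exact (((h1.mul_right h2).mul_right h1.inv_right).mul_right h2.inv_right).eq
    rintro g ((⟨σ, rfl⟩ | ⟨⟨l, m⟩, rfl⟩) | ⟨⟨l, m⟩, rfl⟩)
    · have h := hc i₀ j₀ k₀ hi₀ hk₀ hk₀'.symm
      have h2 : S σ * c * (S σ)⁻¹ = c := by
        conv_lhs => rw [← h]
        rw [conjugate_commutatorElement, hx.conj, hy.conj]
        exact hc _ _ _ (σ.injective.ne hi₀) (σ.injective.ne hk₀) (σ.injective.ne hk₀'.symm)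
      exact mul_inv_eq_iff_eq_mul.1 h2
    · obtain ⟨i, j, k, h1, h2, h3, h4, h5, h6, h7, h8, h9⟩ := hcx l m
      rw [← hc i j k h1 h2 h3]
      exact comm4 _ _ _ (hx.comm _ _ _ _) (disj _ _ _ _ h8.symm h6.symm h9.symm h7.symm)
    · obtain ⟨i, j, k, h1, h2, h3, h4, h5, h6, h7, h8, h9⟩ := hcx l m
      rw [← hc i j k h1 h2 h3]
      exact comm4 _ _ _ (disj _ _ _ _ h4 h5 h6 h7).symm (hy.comm _ _ _ _)
  refine ⟨c, hcenter, ?_⟩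
  have base1 : ∀ i k o, i ≠ o → k ≠ o → i ≠ k →
      x i o * y k o * (x i o)⁻¹ = y k o * c ^ (1 : ℤ) := by
    intro i k o h1 h2 h3
    rw [zpow_comm_of_center hcenter, zpow_one, ← hc i o k h1 h2 h3, commutatorElement_def]
    group
  have base2 : ∀ i o, i ≠ o → x i o * y i o * (x i o)⁻¹ = y i o * c ^ (2 : ℤ) := by
    intro i o h
    obtain ⟨l, l1, l2, -⟩ := h6 i o o o o
    have h1 := conj_zpow_inv_right hcenter (conj_zpow_inv_left hcenter
      (base1 o l i h.symm l1 l2.symm))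
    have h2 := base1 i l o h l2 l1.symm
    simp only [hx.inv, hy.inv] at h1
    have h3 := conj_zpow_mul_right hcenter (b := y i l) (by simpa only [hx.inv] using h1) h2
    rw [hy.mul] at h3
    simpa using h3
  have base : ∀ i k o, i ≠ o → k ≠ o →
      x i o * y k o * (x i o)⁻¹ = y k o * c ^ (1 + if i = k then 1 else 0 : ℤ) := by
    intro i k o h1 h2
    by_cases h : i = k
    · subst h; simpa using base2 i o h1
    · simpa [h] using base1 i k o h1 h2 h
  intro i j k l
  obtain ⟨o, o1, o2, o3, o4, -⟩ := h6 i j k l l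
  have left : ∀ k, k ≠ o → x i j * y k o * (x i j)⁻¹ =
      y k o * c ^ ((1 + if i = k then 1 else 0) + -(1 + if j = k then 1 else 0) : ℤ) := by
    intro k hk
    have h := conj_zpow_mul_left hcenter (base i k o o1.symm hk)
      (conj_zpow_inv_left hcenter (base j k o o2.symm hk))
    rwa [hx.inv, hx.mul] at h
  have h := conj_zpow_mul_right hcenter (left k o3.symm)
    (conj_zpow_inv_right hcenter (left l o4.symm))
  rw [hy.inv l o, hy.mul] at h
  rw [h]
  congr 2
  simp only [pairing]
  ring
end pair
end heisenberg

section center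
open scoped commutatorElement
variable {G : Type*} [Group G] {V : Type*} [DecidableEq V]

theorem pairing_comm (i j k l : V) : pairing i j k l = pairing k l i j := by
  simp only [pairing, eq_comm (a := k), eq_comm (a := l)]
  ring

namespace IsTranslationFamily
variable {S : Perm V →* G} {x y : V → V → G}

/-- The subgroup of translations. -/
def subgroup (x : V → V → G) : Subgroup G :=
  Subgroup.closure (Set.range fun p : V × V => x p.1 p.2)

omit [DecidableEq V] in
theorem mem_subgroup (x : V → V → G) (i j : V) : x i j ∈ subgroup x :=
  Subgroup.subset_closure ⟨(i, j), rfl⟩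

omit [DecidableEq V] in
theorem conj_mem (hx : IsTranslationFamily S x) (σ : Perm V) {a : G} (ha : a ∈ subgroup x) :
    S σ * a * (S σ)⁻¹ ∈ subgroup x := by
  induction ha using Subgroup.closure_induction with
  | mem a ha =>
    obtain ⟨⟨i, j⟩, rfl⟩ := ha
    rw [hx.conj]
    exact mem_subgroup x _ _
  | one => simp
  | mul a b _ _ ha hb => rw [← conj_mul]; exact mul_mem ha hb
  | inv a _ ha => rw [← conj_inv]; exact inv_mem ha

omit [DecidableEq V] in
theorem commute_of_mem (hx : IsTranslationFamily S x) {a : G} (ha : a ∈ subgroup x) (i j : V) :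
    Commute a (x i j) := by
  induction ha using Subgroup.closure_induction with
  | mem a ha =>
    obtain ⟨⟨k, l⟩, rfl⟩ := ha
    exact hx.comm _ _ _ _
  | one => exact .one_left _
  | mul a b _ _ ha hb => exact ha.mul_left hb
  | inv a _ ha => exact ha.inv_left

theorem exists_coordinates [Fintype V] (hx : IsTranslationFamily S x) {c : G}
    (hc : c ∈ Subgroup.center G)
    (rel : ∀ i j k l, x i j * y k l * (x i j)⁻¹ = y k l * c ^ pairing i j k l) {a : G}
    (ha : a ∈ subgroup x) :
    ∃ m : V → ℤ, (∀ k l, a * y k l * a⁻¹ = y k l * c ^ (m k - m l)) ∧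
      ((∀ k l, m k = m l) → a = 1) := by
  rcases isEmpty_or_nonempty V with hV | ⟨⟨o⟩⟩
  · refine ⟨0, fun k => hV.elim k, fun _ => ?_⟩
    rwa [subgroup, Set.range_eq_empty, Subgroup.closure_empty, Subgroup.mem_bot] at ha
  let F : (V → Multiplicative ℤ) →* G := MonoidHom.noncommPiCoprod
    (fun k => zpowersHom G (x k o)) fun k l _ m n => by
      simpa only [zpowersHom_apply] using (hx.comm k o l o).zpow_zpow _ _
  have hF : ∀ k n, F (Pi.mulSingle k n) = x k o ^ n.toAdd := fun k n =>
    (MonoidHom.noncommPiCoprod_mulSingle (N := fun _ => Multiplicative ℤ) _ k n).trans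
      (zpowersHom_apply G _ n)
  obtain ⟨m, hm, rfl, h⟩ : ∃ m : V → Multiplicative ℤ, ∏ k, m k = 1 ∧ a = F m ∧
      ∀ k l, a * y k l * a⁻¹ = y k l * c ^ ((m k).toAdd - (m l).toAdd) := by
    induction ha using Subgroup.closure_induction with
    | mem a ha =>
      obtain ⟨⟨i, j⟩, rfl⟩ := ha
      refine ⟨Pi.mulSingle i (.ofAdd 1) * (Pi.mulSingle j (.ofAdd 1))⁻¹, ?_, ?_, fun k l => ?_⟩
      · simp [Finset.prod_mul_distrib]
      · simp only [map_mul, map_inv, hF, toAdd_ofAdd, zpow_one, hx.inv, hx.mul]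
      · rw [rel]
        congr 2
        simp only [pairing, Pi.mul_apply, Pi.inv_apply, Pi.mulSingle_apply, toAdd_mul, toAdd_inv,
          apply_ite Multiplicative.toAdd, toAdd_ofAdd, toAdd_one, eq_comm (a := k),
          eq_comm (a := l)]
        ring
    | one => exact ⟨1, by simp, by simp, by simp⟩
    | mul a b _ _ ha hb =>
      obtain ⟨m, hm, rfl, h⟩ := ha
      obtain ⟨n, hn, rfl, h'⟩ := hb
      refine ⟨m * n, by simp [Finset.prod_mul_distrib, hm, hn], by simp, fun k l => ?_⟩
      rw [conj_zpow_mul_left hc (h k l) (h' k l)]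
      congr 2
      simp only [Pi.mul_apply, toAdd_mul]
      ring
    | inv a _ ha =>
      obtain ⟨m, hm, rfl, h⟩ := ha
      refine ⟨m⁻¹, by simp [hm], by simp, fun k l => ?_⟩
      rw [conj_zpow_inv_left hc (h k l)]
      congr 2
      simp only [Pi.inv_apply, toAdd_inv]
      ring
  refine ⟨fun k => (m k).toAdd, h, fun hconst => ?_⟩
  have h1 : m = fun _ => m o := funext fun k => Multiplicative.toAdd.injective (hconst k o)
  rw [h1, Finset.prod_const, Finset.card_univ] at hm
  have h2 : Fintype.card V * (m o).toAdd = 0 := by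
    simpa using congrArg Multiplicative.toAdd hm
  have h3 : m o = 1 := by
    have : Nonempty V := ⟨o⟩
    simpa [Fintype.card_ne_zero] using h2
  rw [h1, h3]
  exact map_one F

variable {c : G} (hc : c ∈ Subgroup.center G)
  (rel : ∀ i j k l, x i j * y k l * (x i j)⁻¹ = y k l * c ^ pairing i j k l)
include hc rel

theorem rel_symm (i j k l : V) :
    y i j * x k l * (y i j)⁻¹ = x k l * c⁻¹ ^ pairing i j k l := by
  have h := mul_inv_eq_iff_eq_mul.1 (rel k l i j)
  rw [pairing_comm, inv_zpow, eq_mul_inv_iff_mul_eq, mul_assoc _ (y i j)⁻¹,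
    zpow_comm_of_center hc, ← mul_assoc, mul_inv_eq_iff_eq_mul, h, mul_assoc, mul_assoc,
    zpow_comm_of_center hc]

theorem exists_decomposition [Fintype V] (hx : IsTranslationFamily S x)
    (hy : IsTranslationFamily S y)
    (gen : Subgroup.closure
      (Set.range S ∪ Set.range (fun p : V × V => x p.1 p.2) ∪
        Set.range (fun p : V × V => y p.1 p.2)) = ⊤) (g : G) :
    ∃ a ∈ subgroup x, ∃ b ∈ subgroup y, ∃ (z : ℤ) (σ : Perm V), g = a * b * c ^ z * S σ := by
  have hg : g ∈ Subgroup.closure (Set.range S ∪ Set.range (fun p : V × V => x p.1 p.2) ∪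
      Set.range (fun p : V × V => y p.1 p.2)) := gen ▸ Subgroup.mem_top g
  have hS : ∀ σ : Perm V, ∀ g, (∃ a ∈ subgroup x, ∃ b ∈ subgroup y, ∃ (z : ℤ) (τ : Perm V),
      g = a * b * c ^ z * S τ) → ∃ a ∈ subgroup x, ∃ b ∈ subgroup y, ∃ (z : ℤ) (τ : Perm V),
      S σ * g = a * b * c ^ z * S τ := by
    rintro σ _ ⟨a, ha, b, hb, z, τ, rfl⟩
    refine ⟨_, hx.conj_mem σ ha, _, hy.conj_mem σ hb, z, σ * τ, ?_⟩
    rw [map_mul, conj_mul, mul_assoc _ (S σ)⁻¹ (c ^ z), zpow_comm_of_center hc z (S σ)⁻¹]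
    group
  have hX : ∀ i j, ∀ g, (∃ a ∈ subgroup x, ∃ b ∈ subgroup y, ∃ (z : ℤ) (τ : Perm V),
      g = a * b * c ^ z * S τ) → ∃ a ∈ subgroup x, ∃ b ∈ subgroup y, ∃ (z : ℤ) (τ : Perm V),
      x i j * g = a * b * c ^ z * S τ := by
    rintro i j _ ⟨a, ha, b, hb, z, τ, rfl⟩
    exact ⟨_, mul_mem (mem_subgroup x i j) ha, b, hb, z, τ, by simp only [mul_assoc]⟩
  have hY : ∀ i j, ∀ g, (∃ a ∈ subgroup x, ∃ b ∈ subgroup y, ∃ (z : ℤ) (τ : Perm V),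
      g = a * b * c ^ z * S τ) → ∃ a ∈ subgroup x, ∃ b ∈ subgroup y, ∃ (z : ℤ) (τ : Perm V),
      y i j * g = a * b * c ^ z * S τ := by
    rintro i j _ ⟨a, ha, b, hb, z, τ, rfl⟩
    obtain ⟨m, hm, -⟩ := hx.exists_coordinates hc rel (inv_mem ha)
    refine ⟨a, ha, _, mul_mem (mem_subgroup y i j) hb, m i - m j + z, τ, ?_⟩
    have h : y i j * a = a * (y i j * c ^ (m i - m j)) := by rw [← hm]; group
    rw [zpow_add]
    simp only [← mul_assoc, h]
    rw [mul_assoc (a * y i j), ← zpow_comm_of_center hc (m i - m j) b]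
    simp only [mul_assoc]
  induction hg using Subgroup.closure_induction_left with
  | one => exact ⟨1, one_mem _, 1, one_mem _, 0, 1, by simp⟩
  | mul_left s hs g _ ih =>
    rcases hs with (⟨σ, rfl⟩ | ⟨⟨l, m⟩, rfl⟩) | ⟨⟨l, m⟩, rfl⟩
    exacts [hS _ _ ih, hX _ _ _ ih, hY _ _ _ ih]
  | inv_mul_cancel s hs g _ ih =>
    rcases hs with (⟨σ, rfl⟩ | ⟨⟨l, m⟩, rfl⟩) | ⟨⟨l, m⟩, rfl⟩
    · rw [← map_inv]; exact hS _ _ ih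
    · rw [hx.inv]; exact hX _ _ _ ih
    · rw [hy.inv]; exact hY _ _ _ ih

end IsTranslationFamily

open IsTranslationFamily

theorem nonempty_center_mulEquiv_int {S : Perm V →* G} {x y : V → V → G} [Fintype V]
    (h6 : ∀ a b c d e : V, ∃ z, z ≠ a ∧ z ≠ b ∧ z ≠ c ∧ z ≠ d ∧ z ≠ e)
    (hx : IsTranslationFamily S x) (hy : IsTranslationFamily S y)
    (disj : ∀ i j k l, i ≠ k → i ≠ l → j ≠ k → j ≠ l → Commute (x i j) (y k l))
    (hR : ∀ i j k, i ≠ j → j ≠ k → i ≠ k → x i j * y i k * x j k = y i j * x i k * y j k)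
    (gen : Subgroup.closure
      (Set.range S ∪ Set.range (fun p : V × V => x p.1 p.2) ∪
        Set.range (fun p : V × V => y p.1 p.2)) = ⊤)
    {i j k : V} (hij : i ≠ j) (hkj : k ≠ j) (hik : i ≠ k)
    (hinf : ∀ n : ℤ, ⁅x i j, y k j⁆ ^ n = 1 → n = 0) :
    Nonempty (Subgroup.center G ≃* Multiplicative ℤ) := by
  obtain ⟨c, hc, rel⟩ := exists_commutator_eq h6 hx hy disj hR gen
  replace hinf : ∀ m n : ℤ, c ^ m = c ^ n → m = n := by
    intro m n h
    refine sub_eq_zero.1 (hinf _ ?_)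
    have h1 : pairing i j k j = 1 := by simp [pairing, hik, hij, hkj.symm]
    rw [commutatorElement_def, rel, h1, zpow_one, Subgroup.mem_center_iff.1 hc,
      mul_inv_cancel_right, zpow_sub, h, mul_inv_cancel]
  have rel' := rel_symm hc rel
  have key : ∀ g ∈ Subgroup.center G, ∃ z : ℤ, c ^ z = g := by
    intro g hg
    obtain ⟨a, ha, b, hb, z, σ, rfl⟩ := exists_decomposition hc rel hx hy gen g
    obtain ⟨m, hm, ha1⟩ := hx.exists_coordinates hc rel ha
    obtain ⟨n, hn, hb1⟩ := hy.exists_coordinates (inv_mem hc) rel' hb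
    have hgx : ∀ i j, x i j = x (σ i) (σ j) * c⁻¹ ^ (n (σ i) - n (σ j)) := by
      intro i j
      have h1 : x i j = a * (b * (c ^ z * (S σ * x i j * (S σ)⁻¹) * (c ^ z)⁻¹) * b⁻¹) * a⁻¹ := by
        rw [eq_comm]
        trans (a * b * c ^ z * S σ) * x i j * (a * b * c ^ z * S σ)⁻¹
        · group
        · rw [← Subgroup.mem_center_iff.1 hg, mul_inv_cancel_right]
      rw [hx.conj, ← zpow_comm_of_center hc, mul_inv_cancel_right, hn, ← mul_assoc,
        (hx.commute_of_mem ha _ _).eq, mul_assoc, mul_assoc,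
        ← zpow_comm_of_center (inv_mem hc), mul_inv_cancel_left] at h1
      exact h1
    have hpair : ∀ i j k l, pairing i j k l = pairing (σ i) (σ j) k l := by
      intro i j k l
      apply hinf
      have h1 := rel i j k l
      have h2 : ∀ w : ℤ, x (σ i) (σ j) * c⁻¹ ^ w * y k l * (x (σ i) (σ j) * c⁻¹ ^ w)⁻¹ =
          x (σ i) (σ j) * y k l * (x (σ i) (σ j))⁻¹ := by
        intro w
        rw [mul_inv_rev, mul_assoc _ _ (y k l), ← zpow_comm_of_center (inv_mem hc)]
        group
      rw [hgx, h2, rel] at h1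
      exact (mul_left_cancel h1).symm
    have hσ : σ = 1 := by
      ext i
      by_contra h
      change ¬ σ i = i at h
      obtain ⟨j, j1, j2, -⟩ := h6 i (σ i) i i i
      obtain ⟨l, l1, l2, l3, l4, -⟩ := h6 i (σ i) j (σ j) i
      have h1 := hpair i j i l
      simp only [pairing, l1.symm, l2.symm, l3.symm, l4.symm, h, j1, if_true, if_false] at h1
      split_ifs at h1 <;> simp at h1
    subst hσ
    rw [map_one, mul_one] at hg ⊢
    have hb1' : b = 1 := hb1 fun k l => by
      have h1 := hgx k l
      simp only [Perm.coe_one, id] at h1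
      rw [left_eq_mul, inv_zpow', ← zpow_zero c] at h1
      have := hinf _ _ h1
      omega
    subst hb1'
    have ha1' : a = 1 := ha1 fun k l => by
      have h1 := Subgroup.mem_center_iff.1 hg (y k l)
      rw [mul_one, mul_assoc, ← zpow_comm_of_center hc z (y k l)] at h1
      have h2 : a * y k l * a⁻¹ = y k l := by
        rw [mul_inv_eq_iff_eq_mul]
        simpa [← mul_assoc] using h1.symm
      rw [hm, mul_eq_left, ← zpow_zero c] at h2
      have := hinf _ _ h2
      omega
    exact ⟨z, by rw [ha1', one_mul, one_mul]⟩
  refine ⟨(MulEquiv.ofBijective (zpowersHom _ (⟨c, hc⟩ : Subgroup.center G)) ⟨?_, ?_⟩).symm⟩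
  · intro m n h
    exact Multiplicative.toAdd.injective (hinf _ _ (by simpa [Subtype.ext_iff] using h))
  · rintro ⟨g, hg⟩
    obtain ⟨z, rfl⟩ := key g hg
    exact ⟨.ofAdd z, by simp [Subtype.ext_iff]⟩

end center

instance (e : ET) (v : VT) : Decidable (incidentT e v) :=
  inferInstanceAs (Decidable (_ ∨ _))

section generators

theorem exists_perm_hom_fin {G : Type*} [Group G] {n : ℕ} {s : Fin n → G}
    (sq : ∀ i, s i * s i = 1) (comm : ∀ i j : Fin n, (i : ℕ) + 1 < j → Commute (s i) (s j))
    (braid : ∀ i j : Fin n, (i : ℕ) + 1 = j → s i * s j * s i = s j * s i * s j) :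
    ∃ f : Perm (Fin (n + 1)) →* G, ∀ i : Fin n, f (swap i.castSucc i.succ) = s i := by
  have hs : ∀ i (hi : i < n), (if h : i < n then s ⟨i, h⟩ else 1) = s ⟨i, hi⟩ :=
    fun i hi => dif_pos hi
  obtain ⟨f, hf⟩ := exists_perm_hom (s := fun i => if h : i < n then s ⟨i, h⟩ else 1)
    (fun i hi => by rw [hs i hi]; exact sq _)
    (fun i j hij hj => by rw [hs i (by omega), hs j hj]; exact comm _ _ hij)
    (fun i hi => by rw [hs i (by omega), hs _ hi]; exact braid _ _ rfl)
  exact ⟨f, fun i => (hf i).trans (hs i i.2)⟩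

theorem uC_mul_self (e : ET) : uC e * uC e = 1 :=
  PresentedGroup.one_of_mem (rels := CRels) (.inl ⟨e, rfl⟩)

theorem uC_commute {e f : ET} (h : ∀ v, ¬ (incidentT e v ∧ incidentT f v)) :
    Commute (uC e) (uC f) :=
  mul_inv_eq_one.1 (PresentedGroup.one_of_mem (rels := CRels) (.inr (.inl ⟨e, f, h, rfl⟩)))

theorem uC_commute_of_ne {e f : ET} (h : endA e ≠ endA f ∧ endA e ≠ endB f ∧ endB e ≠ endA f ∧
    endB e ≠ endB f) : Commute (uC e) (uC f) := by
  obtain ⟨h1, h2, h3, h4⟩ := h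
  refine uC_commute ?_
  rintro v ⟨rfl | rfl, h' | h'⟩
  exacts [h1 h', h2 h', h3 h', h4 h']

theorem uC_braid {e f : ET} (h : ∃! v, incidentT e v ∧ incidentT f v) :
    uC e * uC f * uC e = uC f * uC e * uC f :=
  mul_inv_eq_one.1 (PresentedGroup.one_of_mem (rels := CRels) (.inr (.inr (.inl ⟨e, f, h, rfl⟩))))

theorem uC_hexagon (p : ZMod 3 × ZMod 3) :
    uC (hexEdge p 0) * uC (hexEdge p 1) * uC (hexEdge p 2) * uC (hexEdge p 3) * uC (hexEdge p 4) =
      uC (hexEdge p 1) * uC (hexEdge p 2) * uC (hexEdge p 3) * uC (hexEdge p 4) *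
        uC (hexEdge p 5) :=
  mul_inv_eq_one.1 (PresentedGroup.one_of_mem (rels := CRels) (.inr (.inr (.inr ⟨p, rfl⟩))))

/-- The vertices of the hexagonal cycle around `p`: the edge `hexEdge p k` joins
`hexVertex p k` to `hexVertex p (k + 1)`. -/
def hexVertex (p : ZMod 3 × ZMod 3) : Fin 6 → VT :=
  ![((p.1, p.2 - 1), true), (p, false), (p, true), ((p.1 - 1, p.2), false),
    ((p.1 - 1, p.2 - 1), true), ((p.1 - 1, p.2 - 1), false)]

theorem hexVertex_injective : ∀ p, Function.Injective (hexVertex p) := by decide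

theorem exists_hexHom (p : ZMod 3 × ZMod 3) : ∃ f : Perm (Fin 6) →* Cgrp,
    ∀ k : Fin 6, f (swap k (k + 1)) = uC (hexEdge p k) := by
  obtain ⟨f, hf⟩ := exists_perm_hom_fin (s := fun i : Fin 5 => uC (hexEdge p i.castSucc))
    (fun i => uC_mul_self _)
    (fun i j hij => uC_commute_of_ne (by revert hij; revert i j; revert p; decide))
    (fun i j hij => uC_braid ⟨hexVertex p j.castSucc, by revert hij; revert i j; revert p; decide⟩)
  refine ⟨f, Fin.lastCases ?_ fun i => by rw [← hf, Fin.coeSucc_eq_succ]⟩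
  have h := uC_hexagon p
  have h5 : swap (Fin.last 5) (Fin.last 5 + 1) =
      (swap 1 2 * swap 2 3 * swap 3 4 * swap 4 5)⁻¹ *
        (swap 0 1 * swap 1 2 * swap 2 3 * swap 3 4 * swap 4 5 : Perm (Fin 6)) := by decide
  rw [h5, map_mul, map_inv, inv_mul_eq_iff_eq_mul]
  simp only [map_mul]
  have h0 : f (swap 0 1) = uC (hexEdge p 0) := hf 0
  have h1 : f (swap 1 2) = uC (hexEdge p 1) := hf 1
  have h2 : f (swap 2 3) = uC (hexEdge p 2) := hf 2
  have h3 : f (swap 3 4) = uC (hexEdge p 3) := hf 3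
  have h4 : f (swap 4 5) = uC (hexEdge p 4) := hf 4
  rw [h0, h1, h2, h3, h4]
  exact h

/-- The consecutive vertices of a Hamiltonian path in `T`. -/
def pathVertex : Fin 18 → VT :=
  ![((0, 0), false), ((0, 0), true), ((2, 0), false), ((2, 0), true), ((1, 0), false),
    ((1, 0), true), ((1, 1), false), ((2, 1), true), ((2, 1), false), ((0, 1), true),
    ((0, 1), false), ((1, 1), true), ((1, 2), false), ((1, 2), true), ((0, 2), false),
    ((0, 2), true), ((2, 2), false), ((2, 2), true)]

/-- The consecutive edges of a Hamiltonian path in `T`. -/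
def pathEdge : Fin 17 → ET :=
  ![((0, 0), 0), ((0, 0), 1), ((2, 0), 0), ((2, 0), 1), ((1, 0), 0), ((1, 1), 2), ((2, 1), 1),
    ((2, 1), 0), ((0, 1), 1), ((0, 1), 0), ((1, 1), 1), ((1, 2), 2), ((1, 2), 0), ((1, 2), 1),
    ((0, 2), 0), ((0, 2), 1), ((2, 2), 0)]

/-- The Hamiltonian path as an enumeration of the vertices of `T`. -/
noncomputable def pathEquiv : Fin 18 ≃ VT := Equiv.ofBijective pathVertex (by decide)

theorem permCongr_pathEquiv (i : Fin 17) :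
    pathEquiv.permCongr (swap i.castSucc i.succ) =
      swap (endA (pathEdge i)) (endB (pathEdge i)) := by
  have h : (endA (pathEdge i) = pathVertex i.castSucc ∧ endB (pathEdge i) = pathVertex i.succ) ∨
      (endA (pathEdge i) = pathVertex i.succ ∧ endB (pathEdge i) = pathVertex i.castSucc) := by
    revert i; decide
  have h1 : pathEquiv.permCongr (swap i.castSucc i.succ) =
      swap (pathVertex i.castSucc) (pathVertex i.succ) :=
    symm_trans_swap_trans _ _ pathEquiv
  rcases h with ⟨h, h'⟩ | ⟨h, h'⟩ <;> rw [h, h', h1]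
  exact swap_comm _ _

theorem exists_pathHom : ∃ S : Perm VT →* Cgrp,
    ∀ i : Fin 17, S (swap (endA (pathEdge i)) (endB (pathEdge i))) = uC (pathEdge i) := by
  obtain ⟨f, hf⟩ := exists_perm_hom_fin (s := fun i : Fin 17 => uC (pathEdge i))
    (fun i => uC_mul_self _)
    (fun i j hij => uC_commute_of_ne (by revert hij; revert i j; decide))
    (fun i j hij => uC_braid ⟨pathVertex j.castSucc, by revert hij; revert i j; decide⟩)
  refine ⟨f.comp pathEquiv.permCongrHom.symm.toMonoidHom, fun i => ?_⟩
  rw [← permCongr_pathEquiv, ← hf]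
  exact congrArg f (pathEquiv.permCongrHom.symm_apply_apply _)

theorem pathHom_ext {G : Type*} [Group G] {f g : Perm VT →* G}
    (h : ∀ i : Fin 17, f (swap (endA (pathEdge i)) (endB (pathEdge i))) =
      g (swap (endA (pathEdge i)) (endB (pathEdge i)))) : f = g := by
  have h1 : f.comp pathEquiv.permCongrHom.toMonoidHom =
      g.comp pathEquiv.permCongrHom.toMonoidHom := by
    refine MonoidHom.eq_of_eqOn_denseM (Equiv.Perm.mclosure_swap_castSucc_succ 17) ?_
    rintro _ ⟨i, rfl⟩
    have h2 := h i
    rw [← permCongr_pathEquiv] at h2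
    exact h2
  ext1 σ
  obtain ⟨τ, rfl⟩ := pathEquiv.permCongrHom.surjective σ
  exact DFunLike.congr_fun h1 τ

end generators

section reflections
variable {V : Type*} [DecidableEq V]

/-- The reflection exchanging `i` and `j`, twisted by the label `a`, acting on
`ℤ × (V → ℤ) × ℤ`. -/
def labelledReflection (i j : V) (a : ℤ × ℤ) (m : ℤ × (V → ℤ) × ℤ) : ℤ × (V → ℤ) × ℤ :=
  (m.1 - a.1 * (m.2.1 i - m.2.1 j + a.2 * m.2.2),
    fun v => m.2.1 v - (m.2.1 i - m.2.1 j + a.2 * m.2.2) *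
      ((if v = i then 1 else 0) - if v = j then 1 else 0),
    m.2.2)

theorem labelledReflection_involutive {i j : V} (h : i ≠ j) (a : ℤ × ℤ) :
    Function.Involutive (labelledReflection i j a) := by
  intro m
  simp only [labelledReflection, h, h.symm, if_true, if_false]
  ext v <;> dsimp only <;> ring

/-- The permutation of `ℤ × (V → ℤ) × ℤ` given by a labelled reflection. -/
def reflectionPerm {i j : V} (h : i ≠ j) (a : ℤ × ℤ) : Perm (ℤ × (V → ℤ) × ℤ) :=
  (labelledReflection_involutive h a).toPerm

theorem reflectionPerm_apply {i j : V} (h : i ≠ j) (a : ℤ × ℤ) (m : ℤ × (V → ℤ) × ℤ) :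
    reflectionPerm h a m = labelledReflection i j a m := rfl

theorem reflectionPerm_mul_self {i j : V} (h : i ≠ j) (a : ℤ × ℤ) :
    reflectionPerm h a * reflectionPerm h a = 1 :=
  Perm.ext (labelledReflection_involutive h a)

theorem reflectionPerm_symm {i j : V} (h : i ≠ j) (a : ℤ × ℤ) :
    reflectionPerm h.symm (-a) = reflectionPerm h a := by
  ext m v <;> simp only [reflectionPerm_apply, labelledReflection, Prod.fst_neg, Prod.snd_neg] <;>
    ring

theorem reflectionPerm_commute {i j k l : V} (hij : i ≠ j) (hkl : k ≠ l) (hik : i ≠ k)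
    (hil : i ≠ l) (hjk : j ≠ k) (hjl : j ≠ l) (a b : ℤ × ℤ) :
    Commute (reflectionPerm hij a) (reflectionPerm hkl b) := by
  ext m v <;> simp only [Perm.mul_apply, reflectionPerm_apply, labelledReflection, hik, hil, hjk,
    hjl, hik.symm, hil.symm, hjk.symm, hjl.symm, if_false] <;> ring

theorem reflectionPerm_conj {i j k : V} (hij : i ≠ j) (hjk : j ≠ k) (hik : i ≠ k) (a b : ℤ × ℤ) :
    reflectionPerm hjk b * reflectionPerm hij a * reflectionPerm hjk b =
      reflectionPerm hik (a + b) := by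
  ext m v <;> simp only [Perm.mul_apply, reflectionPerm_apply, labelledReflection, hij, hjk, hik,
    hij.symm, hjk.symm, hik.symm, if_false, if_true, Prod.fst_add, Prod.snd_add] <;> ring

theorem reflectionPerm_mul {i j k : V} (hij : i ≠ j) (hjk : j ≠ k) (hik : i ≠ k) (a b : ℤ × ℤ) :
    reflectionPerm hij a * reflectionPerm hjk b =
      reflectionPerm hjk b * reflectionPerm hik (a + b) := by
  rw [← reflectionPerm_conj hij hjk hik, ← mul_assoc, ← mul_assoc, reflectionPerm_mul_self,
    one_mul]

theorem reflectionPerm_braid {i j k : V} (hij : i ≠ j) (hjk : j ≠ k) (hik : i ≠ k) (a b : ℤ × ℤ) :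
    reflectionPerm hij a * reflectionPerm hjk b * reflectionPerm hij a =
      reflectionPerm hjk b * reflectionPerm hij a * reflectionPerm hjk b := by
  rw [reflectionPerm_conj hij hjk hik, ← reflectionPerm_symm hij a, ← reflectionPerm_symm hjk b,
    reflectionPerm_conj hjk.symm hij.symm hik.symm, ← reflectionPerm_symm hik (a + b), neg_add_rev]

/-- The action of `Perm V` on `ℤ × (V → ℤ) × ℤ`. -/
def permAction (V : Type*) : Perm V →* Perm (ℤ × (V → ℤ) × ℤ) where
  toFun σ := (Equiv.refl ℤ).prodCongr ((σ.arrowCongr (Equiv.refl ℤ)).prodCongr (Equiv.refl ℤ))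
  map_one' := rfl
  map_mul' _ _ := rfl

omit [DecidableEq V] in
theorem permAction_apply (σ : Perm V) (m : ℤ × (V → ℤ) × ℤ) :
    permAction V σ m = (m.1, m.2.1 ∘ σ.symm, m.2.2) := rfl

theorem permAction_swap {i j : V} (h : i ≠ j) :
    permAction V (swap i j) = reflectionPerm h 0 := by
  ext m v
  · simp [permAction_apply, reflectionPerm_apply, labelledReflection]
  · simp only [permAction_apply, reflectionPerm_apply, labelledReflection, Function.comp_apply,
      symm_swap, swap_apply_def]
    split_ifs <;> simp_all
  · rfl

theorem permAction_conj (σ : Perm V) {i j : V} (h : i ≠ j) (a : ℤ × ℤ) :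
    permAction V σ * reflectionPerm h a * (permAction V σ)⁻¹ =
      reflectionPerm (σ.injective.ne h) a := by
  rw [mul_inv_eq_iff_eq_mul]
  ext m v <;> simp [permAction_apply, reflectionPerm_apply, labelledReflection, symm_apply_eq]

/-- Translation of the first coordinate by multiples of the last one. -/
def shear (V : Type*) : Multiplicative ℤ →* Perm (ℤ × (V → ℤ) × ℤ) where
  toFun n :=
    { toFun m := (m.1 - n.toAdd * m.2.2, m.2)
      invFun m := (m.1 + n.toAdd * m.2.2, m.2)
      left_inv m := by simp
      right_inv m := by simp }
  map_one' := by ext m <;> simp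
  map_mul' k n := by
    ext m
    · simp only [coe_fn_mk, Perm.mul_apply, toAdd_mul]; ring
    all_goals rfl

omit [DecidableEq V] in
theorem shear_apply (n : Multiplicative ℤ) (m : ℤ × (V → ℤ) × ℤ) :
    shear V n m = (m.1 - n.toAdd * m.2.2, m.2) := rfl

omit [DecidableEq V] in
theorem shear_injective : Function.Injective (shear V) := by
  intro m n h
  simpa [shear_apply] using congrArg Prod.fst (DFunLike.congr_fun h (0, 0, 1))

open scoped commutatorElement in
theorem commutator_reflectionPerm {i j k : V} (hij : i ≠ j) (hkj : k ≠ j) (hik : i ≠ k) :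
    ⁅reflectionPerm hij (1, 0) * permAction V (swap i j),
      reflectionPerm hkj (0, 1) * permAction V (swap k j)⁆ = shear V (.ofAdd 1) := by
  rw [commutatorElement_def, mul_inv_eq_iff_eq_mul, mul_inv_eq_iff_eq_mul, permAction_swap hij,
    permAction_swap hkj]
  ext m v <;> simp [reflectionPerm_apply, labelledReflection, shear_apply, hij, hij.symm, hkj, hkj.symm,
    hik, hik.symm] <;> ring

end reflections

section transport
variable {G : Type*} [Group G] {V : Type*} [DecidableEq V] {S : Perm V →* G} {x y : V → V → G}

omit [DecidableEq V] in
theorem exists_perm_apply_eq_four {a b c d a' b' c' d' : V}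
    (h : a ≠ b ∧ a ≠ c ∧ a ≠ d ∧ b ≠ c ∧ b ≠ d ∧ c ≠ d)
    (h' : a' ≠ b' ∧ a' ≠ c' ∧ a' ≠ d' ∧ b' ≠ c' ∧ b' ≠ d' ∧ c' ≠ d') :
    ∃ σ : Perm V, σ a = a' ∧ σ b = b' ∧ σ c = c' ∧ σ d = d' := by
  have inj : ∀ {a b c d : V}, a ≠ b ∧ a ≠ c ∧ a ≠ d ∧ b ≠ c ∧ b ≠ d ∧ c ≠ d →
      Function.Injective ![a, b, c, d] := by
    intro a b c d h s t hst
    fin_cases s <;> fin_cases t <;> simp_all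
  obtain ⟨σ, hσ⟩ := (Perm.isMultiplyPretransitive V 4).exists_smul_eq ⟨_, inj h⟩ ⟨_, inj h'⟩
  exact ⟨σ, DFunLike.congr_fun hσ 0, DFunLike.congr_fun hσ 1, DFunLike.congr_fun hσ 2,
    DFunLike.congr_fun hσ 3⟩

omit [DecidableEq V] in
theorem commute_of_commute (hx : IsTranslationFamily S x) (hy : IsTranslationFamily S y)
    {i₀ j₀ k₀ l₀ : V} (h₀ : i₀ ≠ j₀ ∧ i₀ ≠ k₀ ∧ i₀ ≠ l₀ ∧ j₀ ≠ k₀ ∧ j₀ ≠ l₀ ∧ k₀ ≠ l₀)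
    (h : Commute (x i₀ j₀) (y k₀ l₀)) (i j k l : V) (hik : i ≠ k) (hil : i ≠ l) (hjk : j ≠ k)
    (hjl : j ≠ l) : Commute (x i j) (y k l) := by
  rcases eq_or_ne i j with rfl | hij
  · rw [hx.self]; exact .one_left _
  rcases eq_or_ne k l with rfl | hkl
  · rw [hy.self]; exact .one_right _
  obtain ⟨σ, rfl, rfl, rfl, rfl⟩ := exists_perm_apply_eq_four h₀ ⟨hij, hik, hil, hjk, hjl, hkl⟩
  rw [← hx.conj, ← hy.conj]
  exact (Commute.conj_iff _).2 h

omit [DecidableEq V] in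
theorem triple_eq_of_triple_eq (hx : IsTranslationFamily S x) (hy : IsTranslationFamily S y)
    (h6 : ∀ a b c d e : V, ∃ z, z ≠ a ∧ z ≠ b ∧ z ≠ c ∧ z ≠ d ∧ z ≠ e)
    {i₀ j₀ j₁ k₀ : V} (h₀ : i₀ ≠ j₀ ∧ i₀ ≠ j₁ ∧ i₀ ≠ k₀ ∧ j₀ ≠ j₁ ∧ j₀ ≠ k₀ ∧ j₁ ≠ k₀)
    (h : x i₀ j₀ * y i₀ k₀ * x j₀ k₀ = y i₀ j₁ * x i₀ k₀ * y j₁ k₀) (i j k : V) (hij : i ≠ j)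
    (hjk : j ≠ k) (hik : i ≠ k) : x i j * y i k * x j k = y i j * x i k * y j k := by
  have key : ∀ j j', j ≠ j' → i ≠ j → i ≠ j' → j ≠ k → j' ≠ k →
      x i j * y i k * x j k = y i j' * x i k * y j' k := by
    intro j j' h1 h2 h3 h4 h5
    obtain ⟨σ, rfl, rfl, rfl, rfl⟩ := exists_perm_apply_eq_four h₀ ⟨h2, h3, hik, h1, h4, h5⟩
    simp only [← hx.conj, ← hy.conj, conj_mul, h]
  obtain ⟨j', h1, h2, h3, -⟩ := h6 i j k k k
  obtain ⟨j'', h4, h5, h7, h8, -⟩ := h6 i j k j' j'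
  rw [key j j' h2.symm hij h1.symm hjk h3, ← key j'' j' h8 h4.symm h1.symm h7 h3,
    key j'' j h5 h4.symm hij h7 hjk]

end transport

section labelled
variable {G : Type*} [Group G] {V W : Type*} [DecidableEq V] [DecidableEq W] {f : Perm W →* G}
  {S : Perm V →* G} {ι : W → V} {x y : V → V → G}

/-- The image under `f` of the transposition of `a` and `b` is labelled by the family `x`. -/
def IsLabelled (f : Perm W →* G) (S : Perm V →* G) (ι : W → V) (x : V → V → G) (a b : W) : Prop :=
  f (swap a b) = x (ι a) (ι b) * S (swap (ι a) (ι b))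

theorem IsLabelled.step (hx : ∀ σ i j, S σ * x i j * (S σ)⁻¹ = x (σ i) (σ j))
    (hι : Function.Injective ι) {a b c d : W} (hcd : f (swap c d) = S (swap (ι c) (ι d)))
    (h : IsLabelled f S ι x a b) : IsLabelled f S ι x (swap c d a) (swap c d b) := by
  rw [IsLabelled] at h ⊢
  rw [swap_apply_apply, map_mul, map_mul, map_inv, h, hcd, ← conj_mul, hx, ← hι.swap_apply,
    ← hι.swap_apply, swap_apply_apply, map_mul, map_mul, map_inv]

theorem IsLabelled.triangle (hx : IsTranslationFamily S x) (hy : IsTranslationFamily S y)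
    (hι : Function.Injective ι) {a b c : W} (hab : a ≠ b) (hbc : b ≠ c) (hac : a ≠ c)
    (h : IsLabelled f S ι x a b) (h' : IsLabelled f S ι y b c) :
    f (swap a c) = x (ι a) (ι b) * y (ι a) (ι c) * x (ι b) (ι c) * S (swap (ι a) (ι c)) := by
  have h1 : swap a c = swap a b * swap b c * (swap a b)⁻¹ := by
    rw [← swap_apply_apply, swap_apply_right, swap_apply_of_ne_of_ne hac.symm hbc.symm]
  have h2 : swap (ι a) (ι c) = swap (ι a) (ι b) * swap (ι b) (ι c) * (swap (ι a) (ι b))⁻¹ := by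
    rw [← swap_apply_apply, swap_apply_right, swap_apply_of_ne_of_ne (hι.ne hac.symm) (hι.ne hbc.symm)]
  have h3 := hy.conj (swap (ι a) (ι b)) (ι b) (ι c)
  have h4 := hx.conj (swap (ι a) (ι c)) (ι b) (ι a)
  rw [swap_apply_right, swap_apply_of_ne_of_ne (hι.ne hac.symm) (hι.ne hbc.symm)] at h3
  rw [swap_apply_left, swap_apply_of_ne_of_ne (hι.ne hab.symm) (hι.ne hbc)] at h4
  rw [h1, map_mul, map_mul, map_inv, h, h', mul_inv_rev, hx.inv, ← h3, ← h4, h2]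
  simp only [map_mul, map_inv]
  group

end labelled

section triangulation

/-- The edge `e` is labelled by the family `x`, oriented from `endA e` to `endB e`. -/
def EdgeLabelled (S : Perm VT →* Cgrp) (x : VT → VT → Cgrp) (e : ET) : Prop :=
  uC e = x (endA e) (endB e) * S (swap (endA e) (endB e))

/-- The edge `e` carries the trivial label. -/
def EdgeFlat (S : Perm VT →* Cgrp) (e : ET) : Prop :=
  uC e = S (swap (endA e) (endB e))

theorem hexVertex_eq : ∀ p k,
    (hexVertex p k = endA (hexEdge p k) ∧ hexVertex p (k + 1) = endB (hexEdge p k)) ∨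
      (hexVertex p k = endB (hexEdge p k) ∧ hexVertex p (k + 1) = endA (hexEdge p k)) := by
  decide

section hex
variable {S : Perm VT →* Cgrp} {x : VT → VT → Cgrp} {p : ZMod 3 × ZMod 3}
  {f : Perm (Fin 6) →* Cgrp} (hf : ∀ k : Fin 6, f (swap k (k + 1)) = uC (hexEdge p k))
include hf

theorem edgeFlat_iff (k : Fin 6) : EdgeFlat S (hexEdge p k) ↔
    f (swap k (k + 1)) = S (swap (hexVertex p k) (hexVertex p (k + 1))) := by
  rw [EdgeFlat, hf]
  rcases hexVertex_eq p k with ⟨h, h'⟩ | ⟨h, h'⟩ <;> rw [h, h']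
  rw [swap_comm]

theorem edgeLabelled_iff (k : Fin 6) (h : hexVertex p k = endA (hexEdge p k))
    (h' : hexVertex p (k + 1) = endB (hexEdge p k)) :
    EdgeLabelled S x (hexEdge p k) ↔ IsLabelled f S (hexVertex p) x k (k + 1) := by
  rw [EdgeLabelled, IsLabelled, hf, h, h']

theorem edgeLabelled_iff' (k : Fin 6) (h : hexVertex p k = endB (hexEdge p k))
    (h' : hexVertex p (k + 1) = endA (hexEdge p k)) :
    EdgeLabelled S x (hexEdge p k) ↔ IsLabelled f S (hexVertex p) x (k + 1) k := by
  rw [EdgeLabelled, IsLabelled, swap_comm (k + 1), hf, h, h']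

end hex

theorem edgeFlat_of_hexagon {S : Perm VT →* Cgrp} (p : ZMod 3 × ZMod 3) (k : Fin 6)
    (h : ∀ l, l ≠ k → EdgeFlat S (hexEdge p l)) : EdgeFlat S (hexEdge p k) := by
  obtain ⟨f, hf⟩ := exists_hexHom p
  have hk : ∀ i : Fin 6, k + (i + 1) ≠ k → f (swap (k + (i + 1)) (k + (i + 1) + 1)) =
      S (swap (hexVertex p (k + (i + 1))) (hexVertex p (k + (i + 1) + 1))) :=
    fun i hi => (edgeFlat_iff hf _).1 (h _ hi)
  have ne : ∀ k : Fin 6, k + (0 + 1) ≠ k ∧ k + (1 + 1) ≠ k ∧ k + (2 + 1) ≠ k ∧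
      k + (3 + 1) ≠ k ∧ k + (4 + 1) ≠ k := by decide
  have inj := hexVertex_injective p
  have one : ∀ (σ : Perm VT) (i j : VT), S σ * (fun _ _ : VT => (1 : Cgrp)) i j * (S σ)⁻¹ = 1 :=
    fun σ _ _ => by simp
  have h1 : IsLabelled f S (hexVertex p) (fun _ _ => 1) (k + 1) (k + 1 + 1) := by
    rw [IsLabelled, one_mul]
    exact hk 0 (ne k).1
  have h2 := (((h1.step one inj (hk 1 (ne k).2.1)).step one inj (hk 2 (ne k).2.2.1)).step one inj
    (hk 3 (ne k).2.2.2.1)).step one inj (hk 4 (ne k).2.2.2.2)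
  have key : ∀ k : Fin 6,
      swap (k + (4 + 1)) (k + (4 + 1) + 1) (swap (k + (3 + 1)) (k + (3 + 1) + 1)
        (swap (k + (2 + 1)) (k + (2 + 1) + 1) (swap (k + (1 + 1)) (k + (1 + 1) + 1) (k + 1)))) =
          k + 1 ∧
      swap (k + (4 + 1)) (k + (4 + 1) + 1) (swap (k + (3 + 1)) (k + (3 + 1) + 1)
        (swap (k + (2 + 1)) (k + (2 + 1) + 1) (swap (k + (1 + 1)) (k + (1 + 1) + 1)
          (k + 1 + 1)))) = k := by
    decide
  rw [(key k).1, (key k).2, IsLabelled, one_mul, swap_comm, swap_comm (hexVertex p _)] at h2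
  exact (edgeFlat_iff hf k).2 h2

/-- A `ℤ²`-valued labelling of the edges, oriented from `endA` to `endB`, whose sum around each
hexagonal cycle vanishes. -/
def edgeLabel (e : ET) : ℤ × ℤ :=
  if e = ((0, 0), 2) ∨ e = ((2, 0), 2) then (0, 1)
  else if e = ((1, 0), 1) ∨ e = ((1, 1), 0) ∨ e = ((2, 2), 1) then (1, 0)
  else if e = ((1, 0), 2) then (1, 1)
  else 0

theorem edgeFlat_of_edgeLabel {S : Perm VT →* Cgrp}
    (hS : ∀ i : Fin 17, S (swap (endA (pathEdge i)) (endB (pathEdge i))) = uC (pathEdge i))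
    {e : ET} (he : edgeLabel e = 0) : EdgeFlat S e := by
  have h0 : ∀ e, (∃ i, e = pathEdge i) → EdgeFlat S e := by
    rintro _ ⟨i, rfl⟩
    exact (hS i).symm
  have h1 : ∀ e, ((∃ i, e = pathEdge i) ∨ e = ((0, 2), 2)) → EdgeFlat S e := by
    rintro _ (h | rfl)
    · exact h0 _ h
    · exact edgeFlat_of_hexagon (1, 2) 3 fun l hl => h0 _ (by revert l; decide)
  have h2 : ∀ e, ((∃ i, e = pathEdge i) ∨ e = ((0, 2), 2) ∨ e = ((2, 1), 2)) → EdgeFlat S e := by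
    rintro _ (h | rfl | rfl)
    · exact h0 _ h
    · exact h1 _ (.inr rfl)
    · exact edgeFlat_of_hexagon (2, 1) 0 fun l hl => h1 _ (by revert l; decide)
  have h3 : ∀ e, ((∃ i, e = pathEdge i) ∨ e = ((0, 2), 2) ∨ e = ((2, 1), 2) ∨ e = ((0, 1), 2)) →
      EdgeFlat S e := by
    rintro _ (h | rfl | rfl | rfl)
    · exact h0 _ h
    · exact h2 _ (.inr (.inl rfl))
    · exact h2 _ (.inr (.inr rfl))
    · exact edgeFlat_of_hexagon (0, 1) 0 fun l hl => h2 _ (by revert l; decide)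
  have h4 : EdgeFlat S ((2, 2), 2) :=
    edgeFlat_of_hexagon (0, 2) 3 fun l hl => h3 _ (by revert l; decide)
  have key : ∀ e, edgeLabel e = 0 → ((∃ i, e = pathEdge i) ∨ e = ((0, 2), 2) ∨ e = ((2, 1), 2) ∨
      e = ((0, 1), 2)) ∨ e = ((2, 2), 2) := by
    decide
  rcases key e he with h | rfl
  exacts [h3 e h, h4]

/-- Two vertices are joined by an edge with trivial label, disjoint from `e`. -/
def FlatAdj (e : ET) (v w : VT) : Prop :=
  ∃ f, edgeLabel f = 0 ∧
    (endA e ≠ endA f ∧ endA e ≠ endB f ∧ endB e ≠ endA f ∧ endB e ≠ endB f) ∧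
    (v = endA f ∧ w = endB f ∨ v = endB f ∧ w = endA f)

instance (e : ET) (v w : VT) : Decidable (FlatAdj e v w) :=
  inferInstanceAs (Decidable (∃ _, _))

theorem commute_swap_of_isChain {S : Perm VT →* Cgrp}
    (hS : ∀ e, edgeLabel e = 0 → EdgeFlat S e) {e : ET} (l : List VT)
    (hl : l.IsChain (FlatAdj e)) {v w : VT} (hv : v ∈ l) (hw : w ∈ l) :
    Commute (uC e) (S (swap v w)) := by
  let R : VT → VT → Prop := fun v w => Commute (uC e) (S (swap v w))
  have hR : l.IsChain R := by
    refine hl.imp fun v w h => ?_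
    obtain ⟨f, hf, hef, ⟨rfl, rfl⟩ | ⟨rfl, rfl⟩⟩ := h
    · change Commute (uC e) (S (swap (endA f) (endB f)))
      rw [← hS f hf]
      exact uC_commute_of_ne hef
    · change Commute (uC e) (S (swap (endB f) (endA f)))
      rw [swap_comm, ← hS f hf]
      exact uC_commute_of_ne hef
  have refl : ∀ v, R v v := fun v => by
    have h : swap v v = 1 := swap_self v
    change Commute (uC e) (S (swap v v))
    rw [h, map_one]
    exact .one_right _
  have symm : ∀ v w, R v w → R w v := fun v w h => by
    change Commute (uC e) (S (swap w v))
    rwa [swap_comm]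
  have trans : ∀ a b c, R a b → R b c → R a c := by
    intro a b c h1 h2
    rcases eq_or_ne a c with rfl | hac
    · exact refl a
    rcases eq_or_ne b c with rfl | hbc
    · exact h1
    have h : swap a c = swap a b * swap b c * (swap a b)⁻¹ := by
      rw [← swap_apply_apply, swap_apply_right, swap_apply_of_ne_of_ne hac.symm hbc.symm]
    change Commute (uC e) (S (swap a c))
    rw [h, map_mul, map_mul, map_inv]
    exact (h1.mul_right h2).mul_right h1.inv_right
  have : IsTrans VT R := ⟨trans⟩
  have : Std.Symm R := ⟨symm⟩
  exact (List.isChain_iff_pairwise.1 hR).forall_of_forall (fun _ _ => refl _) hv hw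

theorem commute_swap_diagonal {S : Perm VT →* Cgrp} (hS : ∀ e, edgeLabel e = 0 → EdgeFlat S e)
    (v w : VT) (hv : v ≠ ((1, 1), false) ∧ v ≠ ((1, 1), true))
    (hw : w ≠ ((1, 1), false) ∧ w ≠ ((1, 1), true)) :
    Commute (uC ((1, 1), 0)) (S (swap v w)) := by
  have key : ∀ v : VT, v ≠ ((1, 1), false) ∧ v ≠ ((1, 1), true) →
    v ∈ ([((1, 2), false), ((1, 2), true), ((0, 2), false), ((0, 2), true), ((2, 2), false),
      ((2, 2), true), ((2, 2), false), ((2, 1), true), ((2, 1), false), ((0, 1), true),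
      ((0, 1), false), ((0, 0), true), ((0, 0), false), ((0, 0), true), ((2, 0), false),
      ((2, 0), true), ((1, 0), false), ((1, 0), true)] : List VT) := by decide
  exact commute_swap_of_isChain hS _ (by decide) (key v hv) (key w hw)

theorem commute_swap_bottom {S : Perm VT →* Cgrp} (hS : ∀ e, edgeLabel e = 0 → EdgeFlat S e)
    (v w : VT) (hv : v ≠ ((2, 0), false) ∧ v ≠ ((2, 2), true))
    (hw : w ≠ ((2, 0), false) ∧ w ≠ ((2, 2), true)) :
    Commute (uC ((2, 0), 2)) (S (swap v w)) := by
  have key : ∀ v : VT, v ≠ ((2, 0), false) ∧ v ≠ ((2, 2), true) →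
    v ∈ ([((1, 1), true), ((1, 2), false), ((1, 2), true), ((0, 2), false), ((0, 2), true),
      ((2, 2), false), ((2, 1), true), ((1, 1), false), ((1, 0), true), ((1, 0), false),
      ((2, 0), true), ((2, 1), false), ((0, 1), true), ((0, 1), false), ((0, 0), true),
      ((0, 0), false)] : List VT) := by decide
  exact commute_swap_of_isChain hS _ (by decide) (key v hv) (key w hw)

theorem exists_edgeLabelled {S : Perm VT →* Cgrp} (hS : ∀ e, edgeLabel e = 0 → EdgeFlat S e)
    {e : ET} (he : endA e ≠ endB e)
    (comm : ∀ v w, v ≠ endA e ∧ v ≠ endB e → w ≠ endA e ∧ w ≠ endB e →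
      Commute (uC e) (S (swap v w)))
    {f g : ET} (hf : edgeLabel f = 0) (hg : edgeLabel g = 0)
    (hef : endA f = endA e ∧ endB f ≠ endA e ∧ endB f ≠ endB e)
    (heg : endB g = endB e ∧ endA g ≠ endA e ∧ endA g ≠ endB e) :
    ∃ x, IsTranslationFamily S x ∧ EdgeLabelled S x e := by
  have hef' : ∃! v, incidentT e v ∧ incidentT f v := by
    refine ⟨endA e, ⟨.inl rfl, .inl hef.1.symm⟩, ?_⟩
    rintro v ⟨rfl | rfl, h | h⟩
    exacts [rfl, rfl, h.trans hef.1, (hef.2.2 h.symm).elim]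
  have heg' : ∃! v, incidentT e v ∧ incidentT g v := by
    refine ⟨endB e, ⟨.inr rfl, .inr heg.1.symm⟩, ?_⟩
    rintro v ⟨rfl | rfl, h | h⟩
    exacts [(heg.2.1 h.symm).elim, h.trans heg.1, rfl, rfl]
  have hSf := hS f hf
  have hSg := hS g hg
  rw [EdgeFlat, hef.1] at hSf
  rw [EdgeFlat, swap_comm, heg.1] at hSg
  obtain ⟨x, hx, h⟩ := exists_translationFamily he (uC_mul_self e)
    (fun k l h1 h2 h3 h4 => comm k l ⟨h1, h2⟩ ⟨h3, h4⟩)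
    ⟨endB f, hef.2.1, hef.2.2, hSf ▸ uC_braid hef'⟩ ⟨endA g, heg.2.1, heg.2.2, hSg ▸ uC_braid heg'⟩
  refine ⟨x, hx, ?_⟩
  rw [EdgeLabelled, h, mul_assoc, ← map_mul, swap_mul_self, map_one, mul_one]

section propagation
variable {S : Perm VT →* Cgrp} (hS : ∀ e, edgeLabel e = 0 → EdgeFlat S e)
include hS

theorem IsLabelled.hexStep {x : VT → VT → Cgrp} (hx : IsTranslationFamily S x)
    {p : ZMod 3 × ZMod 3} {f : Perm (Fin 6) →* Cgrp}
    (hf : ∀ k : Fin 6, f (swap k (k + 1)) = uC (hexEdge p k)) {a b : Fin 6}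
    (h : IsLabelled f S (hexVertex p) x a b) (k : Fin 6) (hk : edgeLabel (hexEdge p k) = 0) :
    IsLabelled f S (hexVertex p) x (swap k (k + 1) a) (swap k (k + 1) b) :=
  h.step hx.conj (hexVertex_injective p) ((edgeFlat_iff hf k).1 (hS _ hk))

theorem edgeLabelled_one_zero {x : VT → VT → Cgrp} (hx : IsTranslationFamily S x)
    (h : EdgeLabelled S x ((1, 1), 0)) : EdgeLabelled S x ((1, 0), 1) := by
  obtain ⟨f, hf⟩ := exists_hexHom (1, 1)
  have h1 := (edgeLabelled_iff hf 1 (by decide) (by decide)).1 h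
  have h2 := (((h1.hexStep hS hx hf 0 (by decide)).hexStep hS hx hf 2 (by decide)).hexStep
    hS hx hf 3 (by decide)).hexStep hS hx hf 4 (by decide)
  exact (edgeLabelled_iff' hf 5 (by decide) (by decide)).2 h2

theorem edgeLabelled_two_two {x : VT → VT → Cgrp} (hx : IsTranslationFamily S x)
    (h : EdgeLabelled S x ((1, 1), 0)) : EdgeLabelled S x ((2, 2), 1) := by
  obtain ⟨f, hf⟩ := exists_hexHom (2, 2)
  have h1 := (edgeLabelled_iff' hf 4 (by decide) (by decide)).1 h
  have h2 := (((h1.hexStep hS hx hf 5 (by decide)).hexStep hS hx hf 0 (by decide)).hexStep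
    hS hx hf 1 (by decide)).hexStep hS hx hf 3 (by decide)
  exact (edgeLabelled_iff hf 2 (by decide) (by decide)).2 h2

theorem edgeLabelled_zero_zero {y : VT → VT → Cgrp} (hy : IsTranslationFamily S y)
    (h : EdgeLabelled S y ((2, 0), 2)) : EdgeLabelled S y ((0, 0), 2) := by
  obtain ⟨f, hf⟩ := exists_hexHom (0, 0)
  have h1 := (edgeLabelled_iff hf 3 (by decide) (by decide)).1 h
  have h2 := (((h1.hexStep hS hy hf 2 (by decide)).hexStep hS hy hf 1 (by decide)).hexStep
    hS hy hf 4 (by decide)).hexStep hS hy hf 5 (by decide)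
  exact (edgeLabelled_iff' hf 0 (by decide) (by decide)).2 h2

variable {x y : VT → VT → Cgrp} (hx : IsTranslationFamily S x) (hy : IsTranslationFamily S y)
  (h : EdgeLabelled S x ((1, 1), 0)) (h' : EdgeLabelled S y ((2, 0), 2))
include hx hy h h'

theorem corner_eq : uC ((1, 0), 2) = x ((1, 0), false) ((0, 0), false) *
    y ((1, 0), false) ((1, 2), true) * x ((0, 0), false) ((1, 2), true) *
      S (swap ((1, 0), false) ((1, 2), true)) := by
  obtain ⟨f, hf⟩ := exists_hexHom (1, 0)
  have h1 := (edgeLabelled_iff hf 2 (by decide) (by decide)).1 (edgeLabelled_one_zero hS hx h)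
  have h2 := h1.hexStep hS hx hf 1 (by decide)
  have h3 := (edgeLabelled_iff hf 3 (by decide) (by decide)).1 (edgeLabelled_zero_zero hS hy h')
  have h4 := (h3.hexStep hS hy hf 4 (by decide)).hexStep hS hy hf 5 (by decide)
  have h5 := IsLabelled.triangle (a := 1) (b := 3) (c := 0) hx hy (hexVertex_injective _)
    (by decide) (by decide) (by decide) h2 h4
  rw [swap_comm] at h5
  exact (hf 0).symm.trans h5

theorem corner_eq' : uC ((1, 0), 2) = y ((1, 0), false) ((2, 2), true) *
    x ((1, 0), false) ((1, 2), true) * y ((2, 2), true) ((1, 2), true) *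
      S (swap ((1, 0), false) ((1, 2), true)) := by
  obtain ⟨f, hf⟩ := exists_hexHom (2, 0)
  have h1 := (edgeLabelled_iff' hf 0 (by decide) (by decide)).1 h'
  have h2 := (h1.hexStep hS hy hf 1 (by decide)).hexStep hS hy hf 2 (by decide)
  have h3 := (edgeLabelled_iff' hf 5 (by decide) (by decide)).1 (edgeLabelled_two_two hS hx h)
  have h4 := h3.hexStep hS hx hf 4 (by decide)
  have h5 := IsLabelled.triangle (a := 3) (b := 0) (c := 4) hy hx (hexVertex_injective _)
    (by decide) (by decide) (by decide) h2 h4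
  exact (hf 3).symm.trans h5

omit hx hy in
theorem commute_xy : Commute (x ((1, 1), false) ((1, 1), true))
    (y ((2, 0), false) ((2, 2), true)) := by
  have hx' : x ((1, 1), false) ((1, 1), true) =
      uC ((1, 1), 0) * (S (swap ((1, 1), false) ((1, 1), true)))⁻¹ :=
    eq_mul_inv_of_mul_eq h.symm
  have hy' : y ((2, 0), false) ((2, 2), true) =
      uC ((2, 0), 2) * (S (swap ((2, 0), false) ((2, 2), true)))⁻¹ :=
    eq_mul_inv_of_mul_eq h'.symm
  have h1 := commute_swap_diagonal hS ((2, 0), false) ((2, 2), true) (by decide) (by decide)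
  have h2 := commute_swap_bottom hS ((1, 1), false) ((1, 1), true) (by decide) (by decide)
  have h3 : Commute (uC ((1, 1), 0)) (uC ((2, 0), 2)) := uC_commute_of_ne (by decide)
  have h4 : Commute (S (swap ((1, 1), false) ((1, 1), true)))
      (S (swap ((2, 0), false) ((2, 2), true))) := by
    refine Commute.map (f := S) ?_
    change swap _ _ * swap _ _ = swap _ _ * swap _ _
    decide
  rw [hx', hy']
  exact (h3.mul_right h1.inv_right).mul_left (h2.symm.inv_left.mul_right h4.inv_inv)

theorem closure_eq_top : Subgroup.closure (Set.range S ∪ Set.range (fun p : VT × VT => x p.1 p.2) ∪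
    Set.range (fun p : VT × VT => y p.1 p.2)) = ⊤ := by
  set H := Subgroup.closure (Set.range S ∪ Set.range (fun p : VT × VT => x p.1 p.2) ∪
    Set.range (fun p : VT × VT => y p.1 p.2)) with hH
  have mS : ∀ σ, S σ ∈ H := fun σ => Subgroup.subset_closure (.inl (.inl ⟨σ, rfl⟩))
  have mx : ∀ i j, x i j ∈ H := fun i j => Subgroup.subset_closure (.inl (.inr ⟨(i, j), rfl⟩))
  have my : ∀ i j, y i j ∈ H := fun i j => Subgroup.subset_closure (.inr ⟨(i, j), rfl⟩)
  have mX : ∀ e, EdgeLabelled S x e → uC e ∈ H := fun e he => by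
    rw [he]; exact mul_mem (mx _ _) (mS _)
  have mY : ∀ e, EdgeLabelled S y e → uC e ∈ H := fun e he => by
    rw [he]; exact mul_mem (my _ _) (mS _)
  have key : ∀ e, edgeLabel e = 0 ∨ e = ((1, 0), 2) ∨ e = ((1, 1), 0) ∨ e = ((1, 0), 1) ∨
      e = ((2, 2), 1) ∨ e = ((2, 0), 2) ∨ e = ((0, 0), 2) := by decide
  rw [eq_top_iff, ← PresentedGroup.closure_range_of CRels, Subgroup.closure_le]
  rintro _ ⟨e, rfl⟩
  change uC e ∈ H
  rcases key e with he | rfl | rfl | rfl | rfl | rfl | rfl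
  · rw [hS e he]; exact mS _
  · rw [corner_eq hS hx hy h h']
    exact mul_mem (mul_mem (mul_mem (mx _ _) (my _ _)) (mx _ _)) (mS _)
  · exact mX _ h
  · exact mX _ (edgeLabelled_one_zero hS hx h)
  · exact mX _ (edgeLabelled_two_two hS hx h)
  · exact mY _ h'
  · exact mY _ (edgeLabelled_zero_zero hS hy h')

end propagation
end triangulation

theorem reflectionPerm_hexagon {V : Type*} [DecidableEq V] {v : Fin 6 → V}
    (hv : Function.Injective v) (a : Fin 6 → ℤ × ℤ) (ha : ∑ k, a k = 0) {r : Fin 6 → Perm _}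
    (hr : ∀ k, ∀ h : v k ≠ v (k + 1), r k = reflectionPerm h (a k)) :
    r 0 * r 1 * r 2 * r 3 * r 4 = r 1 * r 2 * r 3 * r 4 * r 5 := by
  have hne : ∀ {i j : Fin 6}, i ≠ j → v i ≠ v j := hv.ne
  have h0 : r 0 = reflectionPerm (hne (by decide : (0 : Fin 6) ≠ 1)) (a 0) := hr 0 _
  have h1 : r 1 = reflectionPerm (hne (by decide : (1 : Fin 6) ≠ 2)) (a 1) := hr 1 _
  have h2 : r 2 = reflectionPerm (hne (by decide : (2 : Fin 6) ≠ 3)) (a 2) := hr 2 _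
  have h3 : r 3 = reflectionPerm (hne (by decide : (3 : Fin 6) ≠ 4)) (a 3) := hr 3 _
  have h4 : r 4 = reflectionPerm (hne (by decide : (4 : Fin 6) ≠ 5)) (a 4) := hr 4 _
  have h5 : r 5 = reflectionPerm (hne (by decide : (5 : Fin 6) ≠ 0)) (a 5) := hr 5 _
  have h6 : a 0 + a 1 + a 2 + a 3 + a 4 = -a 5 := by
    rw [Fin.sum_univ_six] at ha
    exact eq_neg_of_add_eq_zero_left ha
  rw [h5, ← reflectionPerm_symm, ← h6, h0, h1,
    reflectionPerm_mul _ _ (hne (by decide : (0 : Fin 6) ≠ 2)), ← h1, h2, mul_assoc (r 1),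
    reflectionPerm_mul _ _ (hne (by decide : (0 : Fin 6) ≠ 3)), ← h2, ← mul_assoc, h3,
    mul_assoc (r 1 * r 2), reflectionPerm_mul _ _ (hne (by decide : (0 : Fin 6) ≠ 4)), ← h3,
    ← mul_assoc, h4, mul_assoc (r 1 * r 2 * r 3),
    reflectionPerm_mul _ _ (hne (by decide : (0 : Fin 6) ≠ 5)), ← h4, ← mul_assoc]

theorem reflectionPerm_braid_of_inter {V : Type*} [DecidableEq V] {i j k l : V} (hij : i ≠ j)
    (hkl : k ≠ l) (a b : ℤ × ℤ) (h : ∃! v, (v = i ∨ v = j) ∧ (v = k ∨ v = l)) :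
    reflectionPerm hij a * reflectionPerm hkl b * reflectionPerm hij a =
      reflectionPerm hkl b * reflectionPerm hij a * reflectionPerm hkl b := by
  obtain ⟨v, ⟨rfl | rfl, rfl | rfl⟩, h⟩ := h
  · rw [← reflectionPerm_symm hij]
    refine reflectionPerm_braid _ _ ?_ _ _
    rintro rfl
    exact hij.symm (h _ (by simp))
  · rw [← reflectionPerm_symm hij, ← reflectionPerm_symm hkl]
    refine reflectionPerm_braid _ _ ?_ _ _
    rintro rfl
    exact hij.symm (h _ (by simp))
  · refine reflectionPerm_braid _ _ ?_ _ _
    rintro rfl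
    exact hij (h _ (by simp))
  · rw [← reflectionPerm_symm hkl]
    refine reflectionPerm_braid _ _ ?_ _ _
    rintro rfl
    exact hij (h _ (by simp))

section triangulation

theorem endA_ne_endB : ∀ e, endA e ≠ endB e := by decide

/-- The labelled reflection attached to an edge. -/
def edgeReflection (e : ET) : Perm (ℤ × (VT → ℤ) × ℤ) :=
  reflectionPerm (endA_ne_endB e) (edgeLabel e)

theorem edgeReflection_hexEdge (p : ZMod 3 × ZMod 3) (k : Fin 6)
    (h : hexVertex p k ≠ hexVertex p (k + 1)) :
    edgeReflection (hexEdge p k) = reflectionPerm h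
      (if hexVertex p k = endA (hexEdge p k) then edgeLabel (hexEdge p k)
        else -edgeLabel (hexEdge p k)) := by
  have aux : ∀ {i j i' j' : VT} (hi : i = i') (hj : j = j') (hij : i ≠ j) (hij' : i' ≠ j')
      (a : ℤ × ℤ), reflectionPerm hij a = reflectionPerm hij' a := by
    rintro i j _ _ rfl rfl _ _ _
    rfl
  rcases hexVertex_eq p k with ⟨h1, h2⟩ | ⟨h1, h2⟩
  · rw [if_pos h1, edgeReflection]
    exact aux h1.symm h2.symm _ _ _
  · rw [if_neg (h1 ▸ (endA_ne_endB _).symm), edgeReflection, ← reflectionPerm_symm]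
    exact aux h1.symm h2.symm _ _ _

theorem edgeReflection_rels : ∀ r ∈ CRels, FreeGroup.lift edgeReflection r = 1 := by
  have lift_fe : ∀ e, FreeGroup.lift edgeReflection (fe e) = edgeReflection e :=
    fun e => FreeGroup.lift_apply_of
  rintro r (⟨e, rfl⟩ | ⟨e, f, h, rfl⟩ | ⟨e, f, h, rfl⟩ | ⟨p, rfl⟩)
  · rw [map_mul, lift_fe]
    exact reflectionPerm_mul_self _ _
  · simp only [map_mul, map_inv, lift_fe]
    refine mul_inv_eq_one.2 (reflectionPerm_commute _ _ ?_ ?_ ?_ ?_ _ _)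
    · exact fun h' => h _ ⟨.inl rfl, .inl h'⟩
    · exact fun h' => h _ ⟨.inl rfl, .inr h'⟩
    · exact fun h' => h _ ⟨.inr rfl, .inl h'⟩
    · exact fun h' => h _ ⟨.inr rfl, .inr h'⟩
  · simp only [map_mul, map_inv, lift_fe]
    exact mul_inv_eq_one.2 (reflectionPerm_braid_of_inter _ _ _ _ h)
  · simp only [map_mul, map_inv, lift_fe]
    refine mul_inv_eq_one.2 (reflectionPerm_hexagon (hexVertex_injective p) _ ?_
      (r := fun k => edgeReflection (hexEdge p k)) (edgeReflection_hexEdge p))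
    revert p
    decide

/-- The action of the group `C` by labelled reflections. -/
def reflectionRep : Cgrp →* Perm (ℤ × (VT → ℤ) × ℤ) :=
  PresentedGroup.toGroup edgeReflection_rels

theorem reflectionRep_uC (e : ET) : reflectionRep (uC e) = edgeReflection e :=
  PresentedGroup.toGroup.of edgeReflection_rels

theorem reflectionRep_comp_pathHom {S : Perm VT →* Cgrp}
    (hS : ∀ i : Fin 17, S (swap (endA (pathEdge i)) (endB (pathEdge i))) = uC (pathEdge i)) :
    reflectionRep.comp S = permAction VT := by
  refine pathHom_ext fun i => ?_
  have h : edgeLabel (pathEdge i) = 0 := by revert i; decide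
  rw [MonoidHom.comp_apply, hS, reflectionRep_uC, edgeReflection, h,
    permAction_swap (endA_ne_endB _)]

theorem reflectionRep_translation {S : Perm VT →* Cgrp} {x : VT → VT → Cgrp}
    (hS : reflectionRep.comp S = permAction VT) (hx : IsTranslationFamily S x) {e : ET}
    (h : EdgeLabelled S x e) {i j : VT} (hij : i ≠ j) :
    reflectionRep (x i j) = reflectionPerm hij (edgeLabel e) * permAction VT (swap i j) := by
  obtain ⟨σ, rfl, rfl⟩ := exists_perm_apply_eq (endA_ne_endB e) hij
  have hS' : ∀ σ, reflectionRep (S σ) = permAction VT σ := DFunLike.congr_fun hS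
  rw [← hx.conj, map_mul, map_mul, map_inv, eq_mul_inv_of_mul_eq h.symm, map_mul, map_inv,
    reflectionRep_uC, hS', hS', edgeReflection, swap_apply_apply, map_mul, map_mul, map_inv,
    ← permAction_conj σ (endA_ne_endB e), ← map_inv (permAction VT) (swap _ _), swap_inv]
  group

open scoped commutatorElement in
theorem eq_zero_of_commutator_zpow_eq_one {S : Perm VT →* Cgrp} {x y : VT → VT → Cgrp}
    (hS : reflectionRep.comp S = permAction VT) (hx : IsTranslationFamily S x)
    (hy : IsTranslationFamily S y) (h : EdgeLabelled S x ((1, 1), 0))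
    (h' : EdgeLabelled S y ((2, 0), 2)) {i j k : VT} (hij : i ≠ j) (hkj : k ≠ j) (hik : i ≠ k)
    (n : ℤ) (hn : ⁅x i j, y k j⁆ ^ n = 1) : n = 0 := by
  have hn' := congrArg reflectionRep hn
  have e1 : edgeLabel ((1, 1), 0) = (1, 0) := by decide
  have e2 : edgeLabel ((2, 0), 2) = (0, 1) := by decide
  rw [map_zpow, map_commutatorElement, reflectionRep_translation hS hx h hij,
    reflectionRep_translation hS hy h' hkj, e1, e2, commutator_reflectionPerm hij hkj hik,
    ← map_zpow (shear VT), map_one reflectionRep, ← map_one (shear VT)] at hn'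
  have h2 := congrArg Multiplicative.toAdd (shear_injective hn')
  simpa using h2

theorem VT.exists_ne (a b c d e : VT) : ∃ z, z ≠ a ∧ z ≠ b ∧ z ≠ c ∧ z ≠ d ∧ z ≠ e := by
  obtain ⟨z, -, hz⟩ := Finset.exists_mem_notMem_of_card_lt_card
    (s := ({a, b, c, d, e} : Finset VT)) (t := Finset.univ)
    (Finset.card_le_five.trans_lt (by decide))
  exact ⟨z, by simpa using hz⟩

end triangulation

/-- The center of the group `C` is infinite cyclic (isomorphic to `ℤ`). -/
theorem stmt19 :
    Nonempty (↥(Subgroup.center Cgrp) ≃* Multiplicative ℤ) := by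
  obtain ⟨S, hS⟩ := exists_pathHom
  have flat := fun e => edgeFlat_of_edgeLabel (e := e) hS
  obtain ⟨x, hx, h⟩ := exists_edgeLabelled flat (e := ((1, 1), 0)) (endA_ne_endB _)
    (commute_swap_diagonal flat) (f := ((1, 1), 2)) (g := ((1, 2), 2)) (by decide) (by decide)
    (by decide) (by decide)
  obtain ⟨y, hy, h'⟩ := exists_edgeLabelled flat (e := ((2, 0), 2)) (endA_ne_endB _)
    (commute_swap_bottom flat) (f := ((2, 0), 0)) (g := ((2, 2), 0)) (by decide) (by decide)
    (by decide) (by decide)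
  refine nonempty_center_mulEquiv_int VT.exists_ne hx hy
    (commute_of_commute hx hy (by decide) (commute_xy flat h h'))
    (triple_eq_of_triple_eq hx hy VT.exists_ne (i₀ := ((1, 0), false)) (j₀ := ((0, 0), false))
      (j₁ := ((2, 2), true)) (k₀ := ((1, 2), true)) (by decide) ?_)
    (closure_eq_top flat hx hy h h') (i := ((0, 0), false)) (j := ((1, 0), false))
    (k := ((2, 0), false)) (by decide) (by decide) (by decide)
    (eq_zero_of_commutator_zpow_eq_one (reflectionRep_comp_pathHom hS) hx hy h h' (by decide) (by decide)
      (by decide))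
  exact mul_right_cancel ((corner_eq flat hx hy h h').symm.trans (corner_eq' flat hx hy h h'))
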